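/- arXiv:1707.07557 — 2 statements merged into one kernel-verified Lean document; each statement's English description precedes it below -/
import Mathlib

section
/- Let n ≥ 3 and let D be a nonempty bounded open connected subset of ℝⁿ. Let u be continuous on the closure of D, twice continuously differentiable on D, vanishing at every point of ∂D, and suppose Δu is bounded on D with sup_D |Δu| > 0. Then sup_{x∈D} |u(x)| ≤ ((n−1)² + 1)/(2n(n−2)ω_n^{2/n}) · ‖Δu‖₁^{2/n} · ‖Δu‖_∞^{(n−2)/n} − ‖Δu‖₁ / (n(n−2) ω_n R^{n−2}), where R = (|D|/ω_n)^{1/n}. -/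
open MeasureTheory Set Metric Filter

noncomputable section

abbrev Euc (n : ℕ) := EuclideanSpace ℝ (Fin n)

/-- The Laplacian `Δu(x) = ∑ i, ∂²u/∂x_i²(x)`. -/
def lapl {n : ℕ} (u : Euc n → ℝ) (x : Euc n) : ℝ :=
  ∑ i : Fin n, fderiv ℝ (fun y => fderiv ℝ u y (EuclideanSpace.single i 1)) x
    (EuclideanSpace.single i 1)

theorem hasDerivAt_normSq_line {n : ℕ} (z : Euc n) (i : Fin n) (t : ℝ) :
    HasDerivAt (fun t : ℝ => ‖z + t • EuclideanSpace.single i (1 : ℝ)‖ ^ 2) (2 * (z i + t)) t := by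
  have h : HasDerivAt (fun t : ℝ => z + t • EuclideanSpace.single i (1 : ℝ))
      (EuclideanSpace.single i (1 : ℝ)) t := by
    simpa using ((hasDerivAt_id t).smul_const (EuclideanSpace.single i (1 : ℝ))).const_add z
  convert h.norm_sq using 1
  simp [EuclideanSpace.inner_single_right]

theorem hasDerivAt_regKernel_line {n : ℕ} {d : ℝ} (hd : 0 < d) (p : ℝ) (z : Euc n) (i : Fin n)
    (t : ℝ) :
    HasDerivAt (fun t : ℝ => (‖z + t • EuclideanSpace.single i (1 : ℝ)‖ ^ 2 + d) ^ p)
      (2 * p * (z i + t) * (‖z + t • EuclideanSpace.single i (1 : ℝ)‖ ^ 2 + d) ^ (p - 1)) t := by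
  have h := ((hasDerivAt_normSq_line z i t).add_const d).rpow_const (p := p)
    (Or.inl (by positivity))
  convert h using 1
  ring

theorem hasDerivAt_deriv_regKernel_line {n : ℕ} {d : ℝ} (hd : 0 < d) (p : ℝ) (z : Euc n)
    (i : Fin n) (t : ℝ) :
    HasDerivAt (fun t : ℝ => 2 * p * (z i + t) *
        (‖z + t • EuclideanSpace.single i (1 : ℝ)‖ ^ 2 + d) ^ (p - 1))
      (2 * p * (‖z + t • EuclideanSpace.single i (1 : ℝ)‖ ^ 2 + d) ^ (p - 1) +
        4 * p * (p - 1) * (z i + t) ^ 2 *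
          (‖z + t • EuclideanSpace.single i (1 : ℝ)‖ ^ 2 + d) ^ (p - 2)) t := by
  have h1 : HasDerivAt (fun t : ℝ => 2 * p * (z i + t)) (2 * p) t := by
    simpa using ((hasDerivAt_id t).const_add (z i)).const_mul (2 * p)
  refine (h1.mul (hasDerivAt_regKernel_line hd (p - 1) z i t)).congr_deriv ?_
  rw [show p - 1 - 1 = p - 2 by ring]
  ring

theorem sq_coord_add_le {n : ℕ} (z : Euc n) (i : Fin n) (t : ℝ) :
    (z i + t) ^ 2 ≤ ‖z + t • EuclideanSpace.single i (1 : ℝ)‖ ^ 2 := by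
  have h := PiLp.norm_apply_le (z + t • EuclideanSpace.single i (1 : ℝ)) i
  have h2 : (z + t • EuclideanSpace.single i (1 : ℝ)) i = z i + t := by simp
  rw [h2, Real.norm_eq_abs] at h
  rw [← sq_abs]
  gcongr

theorem abs_deriv_regKernel_line_le {n : ℕ} {d : ℝ} (hd : 0 < d) {p : ℝ} (hp : p ≤ 0)
    (z : Euc n) (i : Fin n) (t : ℝ) :
    |2 * p * (z i + t) * (‖z + t • EuclideanSpace.single i (1 : ℝ)‖ ^ 2 + d) ^ (p - 1)|
      ≤ 2 * |p| * d ^ (p - 1 / 2) := by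
  have h := sq_coord_add_le z i t
  set s := ‖z + t • EuclideanSpace.single i (1 : ℝ)‖ ^ 2
  have hs : 0 ≤ s := by positivity
  have h1 : |z i + t| ≤ (s + d) ^ (1 / 2 : ℝ) := by
    rw [← Real.sqrt_eq_rpow]
    exact Real.abs_le_sqrt (by linarith)
  rw [abs_mul, abs_mul, abs_mul, abs_two, abs_of_nonneg (Real.rpow_nonneg (by positivity) _),
    mul_assoc]
  gcongr
  calc |z i + t| * (s + d) ^ (p - 1) ≤ (s + d) ^ (1 / 2 : ℝ) * (s + d) ^ (p - 1) := by gcongr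
    _ = (s + d) ^ (p - 1 / 2) := by
      rw [← Real.rpow_add (by positivity)]; congr 1; ring
    _ ≤ d ^ (p - 1 / 2) := Real.rpow_le_rpow_of_nonpos hd (by linarith) (by linarith)

theorem abs_deriv_deriv_regKernel_line_le {n : ℕ} {d : ℝ} (hd : 0 < d) {p : ℝ} (hp : p ≤ 0)
    (z : Euc n) (i : Fin n) (t : ℝ) :
    |2 * p * (‖z + t • EuclideanSpace.single i (1 : ℝ)‖ ^ 2 + d) ^ (p - 1) +
        4 * p * (p - 1) * (z i + t) ^ 2 *
          (‖z + t • EuclideanSpace.single i (1 : ℝ)‖ ^ 2 + d) ^ (p - 2)|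
      ≤ (2 * |p| + 4 * |p| * |p - 1|) * d ^ (p - 1) := by
  have h := sq_coord_add_le z i t
  set s := ‖z + t • EuclideanSpace.single i (1 : ℝ)‖ ^ 2
  have hs : 0 ≤ s := by positivity
  have h0 : (s + d) ^ (p - 1) ≤ d ^ (p - 1) :=
    Real.rpow_le_rpow_of_nonpos hd (by linarith) (by linarith)
  have h1 : (z i + t) ^ 2 * (s + d) ^ (p - 2) ≤ d ^ (p - 1) := by
    calc (z i + t) ^ 2 * (s + d) ^ (p - 2) ≤ (s + d) * (s + d) ^ (p - 2) := by
          gcongr; linarith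
      _ = (s + d) ^ (p - 1) := by
          rw [show p - 1 = 1 + (p - 2) by ring, Real.rpow_add (by positivity), Real.rpow_one]
      _ ≤ _ := h0
  refine (abs_add_le _ _).trans ?_
  rw [add_mul]
  refine add_le_add ?_ ?_
  · rw [abs_mul, abs_mul, abs_two, abs_of_nonneg (Real.rpow_nonneg (by positivity) _)]
    gcongr
  · rw [mul_assoc, abs_mul, abs_mul, abs_mul, abs_of_nonneg (a := (z i + t) ^ 2 * _) (by positivity),
      abs_of_pos (by norm_num : (0 : ℝ) < 4)]
    gcongr

/-- If `f` has a local maximum then its second derivative is nonpositive there. -/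
theorem IsLocalMax.second_deriv_nonpos {f f' : ℝ → ℝ} {a c : ℝ} (h : IsLocalMax f a)
    (hf : ∀ᶠ t in nhds a, HasDerivAt f (f' t) t) (hf' : HasDerivAt f' c a) : c ≤ 0 := by
  by_contra! hc
  have hd : deriv f =ᶠ[nhds a] f' := hf.mono fun t ht => ht.deriv
  have h2 : deriv (deriv f) a = c := by rw [hd.deriv_eq, hf'.deriv]
  have hmin : IsLocalMin f a := isLocalMin_of_deriv_deriv_pos (h2 ▸ hc) h.deriv_eq_zero
    hf.self_of_nhds.continuousAt
  have hconst : f =ᶠ[nhds a] fun _ => f a := by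
    filter_upwards [h, hmin] with t h1 h3 using le_antisymm h1 h3
  have h4 : deriv f =ᶠ[nhds a] fun _ => 0 := by
    simpa using hconst.deriv
  rw [h4.deriv_eq] at h2
  simp at h2
  linarith

/-- Potential of the density `f` for the regularised kernel `(‖x‖² + d) ^ p`. -/
def regPot {n : ℕ} (d p : ℝ) (μ : Measure (Euc n)) (f : Euc n → ℝ) (x : Euc n) : ℝ :=
  ∫ y, (‖x - y‖ ^ 2 + d) ^ p * f y ∂μ

theorem continuous_regKernel {n : ℕ} {d : ℝ} (hd : 0 < d) (p : ℝ) (x : Euc n) :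
    Continuous fun y : Euc n => (‖x - y‖ ^ 2 + d) ^ p :=
  Continuous.rpow_const (by fun_prop) fun y => Or.inl (by positivity)

theorem regKernel_le {n : ℕ} {d p : ℝ} (hd : 0 < d) (hp : p ≤ 0) (z : Euc n) :
    (‖z‖ ^ 2 + d) ^ p ≤ d ^ p :=
  Real.rpow_le_rpow_of_nonpos hd (by nlinarith [norm_nonneg z]) hp

theorem integrable_regKernel_mul {n : ℕ} {d p : ℝ} (hd : 0 < d) (hp : p ≤ 0)
    {μ : Measure (Euc n)} {f : Euc n → ℝ} (hf : Integrable f μ) (x : Euc n) :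
    Integrable (fun y => (‖x - y‖ ^ 2 + d) ^ p * f y) μ := by
  refine hf.bdd_mul (c := d ^ p) (continuous_regKernel hd p x).aestronglyMeasurable
    (Eventually.of_forall fun y => ?_)
  rw [Real.norm_of_nonneg (by positivity)]
  exact regKernel_le hd hp _

theorem continuous_regPot {n : ℕ} {d p : ℝ} (hd : 0 < d) (hp : p ≤ 0)
    {μ : Measure (Euc n)} {f : Euc n → ℝ} (hf : Integrable f μ) :
    Continuous (regPot d p μ f) := by
  refine continuous_of_dominated (bound := fun y => d ^ p * |f y|)
    (fun x => (integrable_regKernel_mul hd hp hf x).aestronglyMeasurable)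
    (fun x => Eventually.of_forall fun y => ?_) (hf.abs.const_mul _)
    (Eventually.of_forall fun y => ?_)
  · rw [norm_mul, Real.norm_of_nonneg (by positivity)]
    exact mul_le_mul_of_nonneg_right (regKernel_le hd hp _) (abs_nonneg _)
  · exact Continuous.mul (Continuous.rpow_const (by fun_prop) fun x => Or.inl (by positivity))
      continuous_const

/-- The first and second derivatives of `regPot` along a coordinate line. -/
theorem hasDerivAt_regPot_line {n : ℕ} {d p : ℝ} (hd : 0 < d) (hp : p ≤ 0)
    {μ : Measure (Euc n)} {f : Euc n → ℝ} (hf : Integrable f μ) (x : Euc n) (i : Fin n) (t : ℝ) :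
    HasDerivAt (fun t : ℝ => regPot d p μ f (x + t • EuclideanSpace.single i (1 : ℝ)))
      (∫ y, 2 * p * ((x - y) i + t) *
        (‖x - y + t • EuclideanSpace.single i (1 : ℝ)‖ ^ 2 + d) ^ (p - 1) * f y ∂μ) t := by
  have hx : ∀ (t : ℝ) (y : Euc n), x + t • EuclideanSpace.single i (1 : ℝ) - y =
      x - y + t • EuclideanSpace.single i (1 : ℝ) := fun t y => by abel
  simp only [regPot, hx]
  refine (hasDerivAt_integral_of_dominated_loc_of_deriv_le (μ := μ) (s := univ) (x₀ := t)
    (F := fun t y => (‖x - y + t • EuclideanSpace.single i (1 : ℝ)‖ ^ 2 + d) ^ p * f y)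
    (F' := fun t y => 2 * p * ((x - y) i + t) *
        (‖x - y + t • EuclideanSpace.single i (1 : ℝ)‖ ^ 2 + d) ^ (p - 1) * f y)
    (bound := fun y => 2 * |p| * d ^ (p - 1 / 2) * |f y|) univ_mem
    (Eventually.of_forall fun t => ?_) ?_ ?_ ?_ (hf.abs.const_mul _) ?_).2
  · simpa only [hx] using (integrable_regKernel_mul hd hp hf
      (x + t • EuclideanSpace.single i (1 : ℝ))).aestronglyMeasurable
  · simpa only [hx] using integrable_regKernel_mul hd hp hf
      (x + t • EuclideanSpace.single i (1 : ℝ))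
  · refine AEStronglyMeasurable.mul (Continuous.aestronglyMeasurable ?_) hf.aestronglyMeasurable
    refine Continuous.mul (by fun_prop) ?_
    exact Continuous.rpow_const (by fun_prop) fun y => Or.inl (by positivity)
  · refine Eventually.of_forall fun y t _ => ?_
    rw [norm_mul]
    exact mul_le_mul_of_nonneg_right (abs_deriv_regKernel_line_le hd hp _ _ _) (abs_nonneg _)
  · exact Eventually.of_forall fun y t _ =>
      (hasDerivAt_regKernel_line hd p (x - y) i t).mul_const _

theorem hasDerivAt_deriv_regPot_line {n : ℕ} {d p : ℝ} (hd : 0 < d) (hp : p ≤ 0)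
    {μ : Measure (Euc n)} {f : Euc n → ℝ} (hf : Integrable f μ) (x : Euc n) (i : Fin n) :
    Integrable (fun y => (2 * p * (‖x - y‖ ^ 2 + d) ^ (p - 1) +
        4 * p * (p - 1) * ((x - y) i) ^ 2 * (‖x - y‖ ^ 2 + d) ^ (p - 2)) * f y) μ ∧
    HasDerivAt (fun t : ℝ => ∫ y, 2 * p * ((x - y) i + t) *
        (‖x - y + t • EuclideanSpace.single i (1 : ℝ)‖ ^ 2 + d) ^ (p - 1) * f y ∂μ)
      (∫ y, (2 * p * (‖x - y‖ ^ 2 + d) ^ (p - 1) +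
        4 * p * (p - 1) * ((x - y) i) ^ 2 * (‖x - y‖ ^ 2 + d) ^ (p - 2)) * f y ∂μ) 0 := by
  have hmeas : ∀ t : ℝ, AEStronglyMeasurable (fun y : Euc n => 2 * p * ((x - y) i + t) *
        (‖x - y + t • EuclideanSpace.single i (1 : ℝ)‖ ^ 2 + d) ^ (p - 1) * f y) μ := by
    intro t
    refine AEStronglyMeasurable.mul (Continuous.aestronglyMeasurable ?_) hf.aestronglyMeasurable
    refine Continuous.mul (by fun_prop) ?_
    exact Continuous.rpow_const (by fun_prop) fun y => Or.inl (by positivity)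
  have h := hasDerivAt_integral_of_dominated_loc_of_deriv_le (μ := μ) (s := univ) (x₀ := (0 : ℝ))
    (F := fun t y => 2 * p * ((x - y) i + t) *
        (‖x - y + t • EuclideanSpace.single i (1 : ℝ)‖ ^ 2 + d) ^ (p - 1) * f y)
    (F' := fun t y => (2 * p * (‖x - y + t • EuclideanSpace.single i (1 : ℝ)‖ ^ 2 + d) ^ (p - 1) +
        4 * p * (p - 1) * ((x - y) i + t) ^ 2 *
          (‖x - y + t • EuclideanSpace.single i (1 : ℝ)‖ ^ 2 + d) ^ (p - 2)) * f y)
    (bound := fun y => (2 * |p| + 4 * |p| * |p - 1|) * d ^ (p - 1) * |f y|) univ_mem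
    (Eventually.of_forall hmeas) ?_ ?_ ?_ (hf.abs.const_mul _) ?_
  · simpa using h
  · refine (hf.abs.const_mul (2 * |p| * d ^ (p - 1 / 2))).mono' (hmeas 0)
      (Eventually.of_forall fun y => ?_)
    rw [norm_mul]
    exact mul_le_mul_of_nonneg_right (abs_deriv_regKernel_line_le hd hp _ _ _) (abs_nonneg _)
  · refine AEStronglyMeasurable.mul (Continuous.aestronglyMeasurable ?_) hf.aestronglyMeasurable
    refine Continuous.add (Continuous.mul (by fun_prop) ?_) (Continuous.mul (by fun_prop) ?_) <;>
    exact Continuous.rpow_const (by fun_prop) fun y => Or.inl (by positivity)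
  · refine Eventually.of_forall fun y t _ => ?_
    rw [norm_mul]
    exact mul_le_mul_of_nonneg_right (abs_deriv_deriv_regKernel_line_le hd hp _ _ _) (abs_nonneg _)
  · exact Eventually.of_forall fun y t _ =>
      (hasDerivAt_deriv_regKernel_line hd p (x - y) i t).mul_const _

/-- With the exponent `1 - n/2` the Laplacian of the regularised kernel is an explicit
negative multiple of `d (‖x‖² + d) ^ (-n/2 - 1)`. -/
theorem sum_second_deriv_regPot {n : ℕ} {d p : ℝ} (hd : 0 < d) (hpn : p = 1 - n / 2)
    (hp : p ≤ 0) {μ : Measure (Euc n)} {f : Euc n → ℝ} (hf : Integrable f μ) (x : Euc n) :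
    ∑ i : Fin n, ∫ y, (2 * p * (‖x - y‖ ^ 2 + d) ^ (p - 1) +
        4 * p * (p - 1) * ((x - y) i) ^ 2 * (‖x - y‖ ^ 2 + d) ^ (p - 2)) * f y ∂μ =
      2 * p * n * ∫ y, d * (‖x - y‖ ^ 2 + d) ^ (p - 2) * f y ∂μ := by
  rw [← integral_finsetSum _ fun i _ => (hasDerivAt_deriv_regPot_line hd hp hf x i).1,
    ← integral_const_mul]
  refine integral_congr_ae (Eventually.of_forall fun y => ?_)
  simp only
  have hs : ∑ i : Fin n, ((x - y) i) ^ 2 = ‖x - y‖ ^ 2 := by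
    rw [EuclideanSpace.norm_sq_eq]; simp
  have hs' : ∑ i : Fin n, 4 * p * (p - 1) * ((x - y) i) ^ 2 * (‖x - y‖ ^ 2 + d) ^ (p - 2) =
      4 * p * (p - 1) * ‖x - y‖ ^ 2 * (‖x - y‖ ^ 2 + d) ^ (p - 2) := by
    rw [← Finset.sum_mul, ← Finset.mul_sum, hs]
  rw [← Finset.sum_mul, Finset.sum_add_distrib, hs',
    show p - 1 = 1 + (p - 2) by ring, Real.rpow_add (by positivity), Real.rpow_one]
  simp only [Finset.sum_const, Finset.card_univ, Fintype.card_fin, nsmul_eq_mul]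
  have : (1 + (p - 2)) = -(n : ℝ) / 2 := by rw [hpn]; ring
  rw [this]
  ring

theorem setIntegral_ball_norm_sub {n : ℕ} (hn : n ≠ 0) (g : ℝ → ℝ) (x : Euc n) {ρ : ℝ}
    (hρ : 0 ≤ ρ) :
    ∫ y in ball x ρ, g ‖x - y‖ =
      n * volume.real (ball (0 : Euc n) 1) * ∫ s in (0 : ℝ)..ρ, s ^ (n - 1) * g s := by
  have : NeZero n := ⟨hn⟩
  have h1 : ∫ y in ball x ρ, g ‖x - y‖ = ∫ y, (Iio ρ).indicator g ‖x - y‖ := by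
    rw [← integral_indicator measurableSet_ball]
    congr 1 with y
    simp only [indicator, mem_ball, mem_Iio, dist_eq_norm, norm_sub_rev y x]
  rw [h1, integral_sub_left_eq_self (fun z : Euc n => (Iio ρ).indicator g ‖z‖) volume x,
    integral_fun_norm_addHaar, intervalIntegral.integral_of_le hρ,
    integral_Ioc_eq_integral_Ioo, ← Ioi_inter_Iio, ← setIntegral_indicator measurableSet_Iio]
  simp only [finrank_euclideanSpace, Fintype.card_fin, nsmul_eq_mul, smul_eq_mul, mul_assoc]
  refine congrArg _ (congrArg _ (integral_congr_ae (Eventually.of_forall fun s => ?_)))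
  by_cases h : s ∈ Iio ρ <;> simp [h]

theorem pow_mul_regKernel_le {n : ℕ} (hn : 2 ≤ n) {d s : ℝ} (hd : 0 < d) (hs : 0 ≤ s) :
    s ^ (n - 1) * (s ^ 2 + d) ^ (1 - n / 2 : ℝ) ≤ s := by
  have hn' : (2 : ℝ) ≤ n := by exact_mod_cast hn
  rcases hs.eq_or_lt with rfl | hs
  · simp [show n - 1 ≠ 0 by omega]
  have h : (s ^ 2 + d) ^ (1 - n / 2 : ℝ) ≤ (s ^ 2) ^ (1 - n / 2 : ℝ) :=
    Real.rpow_le_rpow_of_nonpos (by positivity) (by linarith) (by linarith)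
  calc s ^ (n - 1) * (s ^ 2 + d) ^ (1 - n / 2 : ℝ)
      ≤ s ^ (n - 1) * (s ^ 2) ^ (1 - n / 2 : ℝ) := by gcongr
    _ = s := by
      rw [← Real.rpow_natCast s (n - 1), ← Real.rpow_natCast s 2, ← Real.rpow_mul hs.le,
        ← Real.rpow_add hs]
      conv_rhs => rw [← Real.rpow_one s]
      congr 1
      push_cast [show 1 ≤ n by omega]
      ring

/-- Bathtub bound: among densities `0 ≤ f ≤ M` of given mass `M ω r ^ n`, the potential at `x` is
largest for `M` times the indicator of the ball of radius `r`. -/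
theorem regPot_le {n : ℕ} (hn : 2 ≤ n) {d M r : ℝ} (hd : 0 < d) (hM : 0 ≤ M) (hr : 0 ≤ r)
    {D : Set (Euc n)} (hD : MeasurableSet D) {f : Euc n → ℝ} (hf : IntegrableOn f D)
    (hf0 : ∀ y, 0 ≤ f y) (hfM : ∀ y ∈ D, f y ≤ M)
    (hmass : ∫ y in D, f y = M * volume.real (ball (0 : Euc n) 1) * r ^ n) (x : Euc n) :
    regPot d (1 - n / 2) (volume.restrict D) f x ≤
      M * n * volume.real (ball (0 : Euc n) 1) * r ^ 2 / 2 := by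
  have hn' : (2 : ℝ) ≤ n := by exact_mod_cast hn
  have hp : (1 - n / 2 : ℝ) ≤ 0 := by linarith
  set ω := volume.real (ball (0 : Euc n) 1)
  have hω : 0 ≤ ω := measureReal_nonneg
  set k : ℝ → ℝ := fun s => (s ^ 2 + d) ^ (1 - n / 2 : ℝ) with hk
  have hanti : ∀ s t : ℝ, 0 ≤ s → s ≤ t → k t ≤ k s := fun s t hs hst =>
    Real.rpow_le_rpow_of_nonpos (by positivity) (by gcongr) hp
  have hkc : Continuous k := Continuous.rpow_const (by fun_prop) fun y => Or.inl (by positivity)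
  set g : Euc n → ℝ := (ball x r).indicator fun y => M * (k ‖x - y‖ - k r) with hg
  have hg0 : ∀ y, 0 ≤ g y := fun y => indicator_nonneg (fun y hy => by
    have : ‖x - y‖ ≤ r := by rw [norm_sub_rev, ← dist_eq_norm]; exact (mem_ball.1 hy).le
    exact mul_nonneg hM (sub_nonneg.2 (hanti _ _ (norm_nonneg _) this))) y
  have hgi : Integrable g := by
    rw [hg, integrable_indicator_iff measurableSet_ball]
    exact ((by fun_prop : Continuous fun y : Euc n => M * (k ‖x - y‖ - k r)).continuousOn
      |>.integrableOn_compact (isCompact_closedBall x r)).mono_set ball_subset_closedBall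
  have hpt : ∀ y ∈ D, (‖x - y‖ ^ 2 + d) ^ (1 - n / 2 : ℝ) * f y ≤ k r * f y + g y := by
    intro y hy
    change k ‖x - y‖ * f y ≤ _
    by_cases h : y ∈ ball x r
    · have h1 : ‖x - y‖ ≤ r := by rw [norm_sub_rev, ← dist_eq_norm]; exact (mem_ball.1 h).le
      rw [hg, indicator_of_mem h]
      nlinarith [hanti _ _ (norm_nonneg _) h1, hfM y hy]
    · have h1 : r ≤ ‖x - y‖ := by
        rw [norm_sub_rev, ← dist_eq_norm]; exact not_lt.1 h
      rw [hg, indicator_of_notMem h]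
      nlinarith [hanti _ _ hr h1, hf0 y]
  have hint : ∫ s in (0 : ℝ)..r, s ^ (n - 1) * (M * (k s - k r)) ≤
      ∫ s in (0 : ℝ)..r, (M * s - M * k r * s ^ (n - 1)) := by
    refine intervalIntegral.integral_mono_on hr (Continuous.intervalIntegrable (by fun_prop) _ _)
      (Continuous.intervalIntegrable (by fun_prop) _ _) fun s hs => ?_
    have := mul_le_mul_of_nonneg_left (pow_mul_regKernel_le hn hd hs.1) hM
    change M * (s ^ (n - 1) * k s) ≤ _ at this
    linarith
  have hval : ∫ s in (0 : ℝ)..r, (M * s - M * k r * s ^ (n - 1)) =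
      M * (r ^ 2 / 2) - M * k r * (r ^ n / n) := by
    rw [intervalIntegral.integral_sub (Continuous.intervalIntegrable (by fun_prop) _ _)
      (Continuous.intervalIntegrable (by fun_prop) _ _), intervalIntegral.integral_const_mul,
      intervalIntegral.integral_const_mul, integral_id, integral_pow,
      show n - 1 + 1 = n by omega]
    push_cast [show 1 ≤ n by omega]
    simp [show n ≠ 0 by omega]
  calc regPot d (1 - n / 2) (volume.restrict D) f x
      ≤ ∫ y in D, (k r * f y + g y) :=
        setIntegral_mono_on (integrable_regKernel_mul hd hp hf x)
          ((hf.const_mul _).add hgi.integrableOn) hD hpt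
    _ = k r * (M * ω * r ^ n) + ∫ y in D, g y := by
        rw [integral_add (hf.const_mul _) hgi.integrableOn, integral_const_mul, hmass]
    _ ≤ k r * (M * ω * r ^ n) + ∫ y, g y := by
        exact add_le_add_right (setIntegral_le_integral hgi (Eventually.of_forall hg0)) _
    _ = k r * (M * ω * r ^ n) +
        n * ω * ∫ s in (0 : ℝ)..r, s ^ (n - 1) * (M * (k s - k r)) := by
        rw [hg, integral_indicator measurableSet_ball,
          setIntegral_ball_norm_sub (by omega) (fun s => M * (k s - k r)) x hr]
    _ ≤ k r * (M * ω * r ^ n) + n * ω * (M * (r ^ 2 / 2) - M * k r * (r ^ n / n)) := by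
        rw [← hval]; gcongr
    _ = M * n * ω * r ^ 2 / 2 := by field_simp; ring

theorem integral_pow_mul_approxDelta {n : ℕ} (hn : n ≠ 0) {d : ℝ} (hd : 0 < d) (ρ : ℝ) :
    ∫ s in (0 : ℝ)..ρ, s ^ (n - 1) * (d * (s ^ 2 + d) ^ (1 - n / 2 - 2 : ℝ)) =
      ρ ^ n * (ρ ^ 2 + d) ^ (-n / 2 : ℝ) / n := by
  have hder : ∀ s : ℝ, HasDerivAt (fun s : ℝ => s ^ n * (s ^ 2 + d) ^ (-n / 2 : ℝ) / n)
      (s ^ (n - 1) * (d * (s ^ 2 + d) ^ (1 - n / 2 - 2 : ℝ))) s := by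
    intro s
    have h1 : HasDerivAt (fun s : ℝ => (s ^ 2 + d) ^ (-n / 2 : ℝ))
        (2 * s * (-n / 2 : ℝ) * (s ^ 2 + d) ^ (-n / 2 - 1 : ℝ)) s := by
      have h2 : HasDerivAt (fun s : ℝ => s ^ 2 + d) (2 * s) s := by
        simpa using (hasDerivAt_pow 2 s).add_const d
      exact h2.rpow_const (Or.inl (by positivity))
    refine (((hasDerivAt_pow n s).mul h1).div_const (n : ℝ)).congr_deriv ?_
    have e1 : (1 - n / 2 - 2 : ℝ) = -n / 2 - 1 := by ring
    have e2 : (s ^ 2 + d) ^ (-n / 2 : ℝ) = (s ^ 2 + d) * (s ^ 2 + d) ^ (-n / 2 - 1 : ℝ) := by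
      rw [show (-n / 2 : ℝ) = 1 + (-n / 2 - 1) by ring, Real.rpow_add (by positivity),
        Real.rpow_one]
      ring_nf
    have e3 : s ^ n = s ^ (n - 1) * s := (pow_sub_one_mul hn s).symm
    rw [e1, e2, e3]
    have : (n : ℝ) ≠ 0 := by exact_mod_cast hn
    field_simp
    ring
  rw [intervalIntegral.integral_eq_sub_of_hasDerivAt (fun s _ => hder s)]
  · simp [hn]
  · refine Continuous.intervalIntegrable ?_ _ _
    refine Continuous.mul (by fun_prop) (Continuous.mul (by fun_prop) ?_)
    exact Continuous.rpow_const (by fun_prop) fun y => Or.inl (by positivity)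

theorem le_integral_approxDelta {n : ℕ} (hn : n ≠ 0) {d ρ m : ℝ} (hd : 0 < d) (hρ : 0 ≤ ρ)
    {D : Set (Euc n)} {f : Euc n → ℝ} (hf : IntegrableOn f D) (hf0 : ∀ y, 0 ≤ f y) {x : Euc n}
    (hball : ball x ρ ⊆ D) (hm : ∀ y ∈ ball x ρ, m ≤ f y) :
    m * (volume.real (ball (0 : Euc n) 1) * (ρ ^ n * (ρ ^ 2 + d) ^ (-n / 2 : ℝ))) ≤
      ∫ y in D, d * (‖x - y‖ ^ 2 + d) ^ (1 - n / 2 - 2 : ℝ) * f y := by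
  have hn' : (n : ℝ) ≠ 0 := by exact_mod_cast hn
  have hp : (1 - n / 2 - 2 : ℝ) ≤ 0 := by
    have : (0 : ℝ) ≤ n := Nat.cast_nonneg n
    linarith
  have hint : IntegrableOn (fun y => d * (‖x - y‖ ^ 2 + d) ^ (1 - n / 2 - 2 : ℝ) * f y) D := by
    simp only [mul_assoc]
    exact (integrable_regKernel_mul hd hp hf x).const_mul d
  have hc : Continuous fun y : Euc n => d * (‖x - y‖ ^ 2 + d) ^ (1 - n / 2 - 2 : ℝ) :=
    continuous_const.mul (continuous_regKernel hd _ x)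
  calc m * (volume.real (ball (0 : Euc n) 1) * (ρ ^ n * (ρ ^ 2 + d) ^ (-n / 2 : ℝ)))
      = (∫ y in ball x ρ, d * (‖x - y‖ ^ 2 + d) ^ (1 - n / 2 - 2 : ℝ)) * m := by
        rw [setIntegral_ball_norm_sub hn (fun s => d * (s ^ 2 + d) ^ (1 - n / 2 - 2 : ℝ)) x hρ,
          integral_pow_mul_approxDelta hn hd]
        field_simp
    _ = ∫ y in ball x ρ, d * (‖x - y‖ ^ 2 + d) ^ (1 - n / 2 - 2 : ℝ) * m :=
        (integral_mul_const _ _).symm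
    _ ≤ ∫ y in ball x ρ, d * (‖x - y‖ ^ 2 + d) ^ (1 - n / 2 - 2 : ℝ) * f y := by
        refine setIntegral_mono_on ?_ (hint.mono_set hball) measurableSet_ball fun y hy => ?_
        · exact ((hc.mul continuous_const).continuousOn.integrableOn_compact
            (isCompact_closedBall x ρ)).mono_set ball_subset_closedBall
        · have := hm y hy
          gcongr
    _ ≤ _ := setIntegral_mono_set hint
        (Eventually.of_forall fun y => mul_nonneg (by positivity) (hf0 y))
        (LE.le.eventuallyLE hball)

theorem contDiffOn_fderiv_apply {n : ℕ} {D : Set (Euc n)} (hD : IsOpen D) {u : Euc n → ℝ}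
    (hu : ContDiffOn ℝ 2 u D) (v : Euc n) : ContDiffOn ℝ 1 (fun y => fderiv ℝ u y v) D :=
  (hu.fderiv_of_isOpen hD (by norm_num)).clm_apply contDiffOn_const

theorem continuousOn_lapl {n : ℕ} {D : Set (Euc n)} (hD : IsOpen D) {u : Euc n → ℝ}
    (hu : ContDiffOn ℝ 2 u D) : ContinuousOn (lapl u) D :=
  continuousOn_finsetSum _ fun _ _ =>
    ((contDiffOn_fderiv_apply hD hu _).continuousOn_fderiv_of_isOpen hD le_rfl).clm_apply
      continuousOn_const

theorem lapl_neg {n : ℕ} (u : Euc n → ℝ) (x : Euc n) : lapl (fun y => -u y) x = -lapl u x := by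
  simp [lapl, fderiv_fun_neg]

theorem hasDerivAt_line {n : ℕ} (x v : Euc n) (t : ℝ) :
    HasDerivAt (fun t : ℝ => x + t • v) v t := by
  simpa using ((hasDerivAt_id t).smul_const v).const_add x

theorem eventually_line_mem {n : ℕ} {D : Set (Euc n)} (hD : IsOpen D) {x : Euc n} (hx : x ∈ D)
    (v : Euc n) : ∀ᶠ t in nhds (0 : ℝ), x + t • v ∈ D := by
  have : Tendsto (fun t : ℝ => x + t • v) (nhds 0) (nhds x) := by
    simpa using (hasDerivAt_line x v 0).continuousAt.tendsto
  exact this.eventually_mem (hD.mem_nhds hx)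

/-- At an interior local maximum of `u - c W + κ ‖·‖²`, where `W` is a regularised potential. -/
theorem lapl_le_of_isLocalMax {n : ℕ} {d p c κ : ℝ} (hd : 0 < d) (hpn : p = 1 - n / 2)
    (hp : p ≤ 0) {μ : Measure (Euc n)} {f : Euc n → ℝ} (hf : Integrable f μ)
    {D : Set (Euc n)} (hD : IsOpen D) {u : Euc n → ℝ} (hu : ContDiffOn ℝ 2 u D) {x : Euc n}
    (hx : x ∈ D) (hmax : IsLocalMax (fun y => u y - c * regPot d p μ f y + κ * ‖y‖ ^ 2) x) :
    lapl u x - c * (2 * p * n * ∫ y, d * (‖x - y‖ ^ 2 + d) ^ (p - 2) * f y ∂μ) + 2 * n * κ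
      ≤ 0 := by
  have key : ∀ i : Fin n, fderiv ℝ (fun y => fderiv ℝ u y (EuclideanSpace.single i 1)) x
      (EuclideanSpace.single i 1) - c * (∫ y, (2 * p * (‖x - y‖ ^ 2 + d) ^ (p - 1) +
        4 * p * (p - 1) * ((x - y) i) ^ 2 * (‖x - y‖ ^ 2 + d) ^ (p - 2)) * f y ∂μ) + 2 * κ
        ≤ 0 := by
    intro i
    set e : Euc n := EuclideanSpace.single i 1
    have hloc : IsLocalMax (fun t : ℝ => u (x + t • e) - c * regPot d p μ f (x + t • e) +
        κ * ‖x + t • e‖ ^ 2) 0 := by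
      have h0 : x + (0 : ℝ) • e = x := by simp
      have := IsLocalMax.comp_continuous (g := fun t : ℝ => x + t • e) (b := 0)
        (by rw [h0]; exact hmax) (hasDerivAt_line x e 0).continuousAt
      exact this
    refine hloc.second_deriv_nonpos (f' := fun t => fderiv ℝ u (x + t • e) e -
      c * (∫ y, 2 * p * ((x - y) i + t) * (‖x - y + t • e‖ ^ 2 + d) ^ (p - 1) * f y ∂μ) +
      κ * (2 * (x i + t))) ?_ ?_
    · filter_upwards [eventually_line_mem hD hx e] with t ht
      have h1 : HasFDerivAt u (fderiv ℝ u (x + t • e)) (x + t • e) :=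
        ((hu.contDiffAt (hD.mem_nhds ht)).differentiableAt (by norm_num)).hasFDerivAt
      exact ((h1.comp_hasDerivAt t (hasDerivAt_line x e t)).sub
        ((hasDerivAt_regPot_line hd hp hf x i t).const_mul c)).add
        ((hasDerivAt_normSq_line x i t).const_mul κ)
    · have h1 : HasFDerivAt (fun y => fderiv ℝ u y e) (fderiv ℝ (fun y => fderiv ℝ u y e) x)
          (x + (0 : ℝ) • e) := by
        rw [zero_smul, add_zero]
        exact (((contDiffOn_fderiv_apply hD hu e).contDiffAt (hD.mem_nhds hx)).differentiableAt
          (by norm_num)).hasFDerivAt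
      have h2 : HasDerivAt (fun t : ℝ => κ * (2 * (x i + t))) (2 * κ) 0 := by
        refine ((((hasDerivAt_id (0 : ℝ)).const_add (x i)).const_mul 2).const_mul κ).congr_deriv ?_
        ring
      exact ((h1.comp_hasDerivAt (0 : ℝ) (hasDerivAt_line x e 0)).sub
        ((hasDerivAt_deriv_regPot_line hd hp hf x i).2.const_mul c)).add h2
  have hsum := Finset.sum_nonpos fun i (_ : i ∈ Finset.univ) => key i
  rw [Finset.sum_add_distrib, Finset.sum_sub_distrib, ← Finset.mul_sum,
    sum_second_deriv_regPot hd hpn hp hf x] at hsum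
  simp only [Finset.sum_const, Finset.card_univ, Fintype.card_fin, nsmul_eq_mul] at hsum
  rw [lapl]
  linarith

theorem exists_pos_mul_one_sub_lt {n : ℕ} {ρ M η : ℝ} (hρ : 0 < ρ) (hη : 0 < η) :
    ∃ d : ℝ, 0 < d ∧ M * (1 - ρ ^ n * (ρ ^ 2 + d) ^ (-n / 2 : ℝ)) < η := by
  have hc : ContinuousAt (fun d : ℝ => M * (1 - ρ ^ n * (ρ ^ 2 + d) ^ (-n / 2 : ℝ))) 0 := by
    refine continuousAt_const.mul (continuousAt_const.sub (continuousAt_const.mul ?_))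
    exact ContinuousAt.rpow_const (by fun_prop) (Or.inl (by positivity))
  have h0 : M * (1 - ρ ^ n * (ρ ^ 2 + 0) ^ (-n / 2 : ℝ)) = 0 := by
    have : (ρ ^ 2) ^ (-n / 2 : ℝ) = (ρ ^ n)⁻¹ := by
      rw [← Real.rpow_natCast ρ 2, ← Real.rpow_mul hρ.le, ← Real.rpow_natCast ρ n,
        ← Real.rpow_neg hρ.le]
      congr 1
      push_cast
      ring
    rw [add_zero, this, mul_inv_cancel₀ (by positivity)]
    simp
  have h1 := hc.tendsto.eventually_lt_const (h0.symm ▸ hη)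
  obtain ⟨d, h2, h3⟩ := ((h1.filter_mono nhdsWithin_le_nhds).and
    (self_mem_nhdsWithin : Ioi (0 : ℝ) ∈ nhdsWithin 0 (Ioi 0))).exists
  exact ⟨d, h3, h2⟩

/-- One-sided pointwise bound by the maximal potential of a density of the same mass and height. -/
theorem le_of_lapl_mass {n : ℕ} (hn : 3 ≤ n) {D : Set (Euc n)} (hDo : IsOpen D)
    (hDb : Bornology.IsBounded D) {u : Euc n → ℝ} (hu_cont : ContinuousOn u (closure D))
    (hu : ContDiffOn ℝ 2 u D) (hu_bdry : ∀ x ∈ frontier D, u x = 0) {M r : ℝ} (hM : 0 ≤ M)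
    (hr : 0 ≤ r) (hlap : ∀ x ∈ D, |lapl u x| ≤ M)
    (hmass : ∫ y in D, |lapl u y| = M * volume.real (ball (0 : Euc n) 1) * r ^ n)
    {x₀ : Euc n} (hx₀ : x₀ ∈ D) : u x₀ ≤ M * r ^ 2 / (2 * (n - 2)) := by
  by_contra! hlt
  have hn' : (3 : ℝ) ≤ n := by exact_mod_cast hn
  have hp : (1 - n / 2 : ℝ) ≤ 0 := by linarith
  set ω := volume.real (ball (0 : Euc n) 1) with hω_def
  have hω : 0 < ω := ENNReal.toReal_pos (measure_ball_pos _ _ one_pos).ne' measure_ball_lt_top.ne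
  set f : Euc n → ℝ := fun y => |lapl u y| with hf_def
  have hf0 : ∀ y, 0 ≤ f y := fun y => abs_nonneg _
  have hfc : ContinuousOn f D := (continuousOn_lapl hDo hu).abs
  have hfi : IntegrableOn f D := by
    refine IntegrableOn.of_bound hDb.measure_lt_top
      (hfc.aestronglyMeasurable hDo.measurableSet) M
      ((ae_restrict_iff' hDo.measurableSet).2 (Eventually.of_forall fun y hy => ?_))
    simpa [hf_def] using hlap y hy
  set c : ℝ := 1 / (n * (n - 2) * ω) with hc_def
  have hc : 0 < c := by
    have : (0 : ℝ) < n - 2 := by linarith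
    positivity
  set ε := u x₀ - M * r ^ 2 / (2 * (n - 2)) with hε_def
  have hε : 0 < ε := sub_pos.2 hlt
  obtain ⟨C, hC0, hC⟩ := hDb.closure.exists_pos_norm_le
  set κ := ε / (4 * C ^ 2) with hκ_def
  have hκ : 0 < κ := by positivity
  set K : Set (Euc n) := closure D ∩ u ⁻¹' Ici (ε / 2) with hK_def
  have hclos : IsCompact (closure D) := hDb.isCompact_closure
  have hK : IsCompact K :=
    hclos.of_isClosed_subset (hu_cont.preimage_isClosed_of_isClosed isClosed_closure isClosed_Ici)
      inter_subset_left
  have hKD : K ⊆ D := fun x hx => by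
    by_contra hxD
    have := hu_bdry x (hDo.frontier_eq ▸ ⟨hx.1, hxD⟩)
    have h2 : ε / 2 ≤ u x := hx.2
    linarith
  have hunif := hK.uniformContinuousAt_of_continuousAt f
    (fun a ha => hfc.continuousAt (hDo.mem_nhds (hKD ha))) (Metric.dist_mem_uniformity hκ)
  obtain ⟨ρ₁, hρ₁, hunif⟩ := Metric.mem_uniformity_dist.1 hunif
  obtain ⟨ρ₂, hρ₂, hthick⟩ := hK.exists_thickening_subset_open hDo hKD
  set ρ := min ρ₁ ρ₂
  have hρ : 0 < ρ := lt_min hρ₁ hρ₂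
  obtain ⟨d, hd, hθ⟩ := exists_pos_mul_one_sub_lt (n := n) (M := M) hρ hκ
  have hw_le : c * regPot d (1 - n / 2) (volume.restrict D) f x₀ ≤
      M * r ^ 2 / (2 * (n - 2)) := by
    refine (mul_le_mul_of_nonneg_left (regPot_le (by omega) hd hM hr hDo.measurableSet hfi hf0
      hlap hmass x₀) hc.le).trans_eq ?_
    have : (n : ℝ) - 2 ≠ 0 := by linarith
    rw [hc_def, ← hω_def]
    field_simp
  have hw0 : ∀ x, 0 ≤ regPot d (1 - n / 2) (volume.restrict D) f x := fun x =>
    integral_nonneg fun y => mul_nonneg (by positivity) (hf0 y)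
  have hε2 : ε ≤ u x₀ := by
    have : 0 ≤ M * r ^ 2 / (2 * ((n : ℝ) - 2)) :=
      div_nonneg (by positivity) (by linarith)
    linarith
  have hx₀K : x₀ ∈ K := ⟨subset_closure hx₀, show ε / 2 ≤ u x₀ by linarith⟩
  obtain ⟨x₁, hx₁K, hmax⟩ := hK.exists_isMaxOn (f := fun y => u y -
      c * regPot d (1 - n / 2) (volume.restrict D) f y + κ * ‖y‖ ^ 2) ⟨x₀, hx₀K⟩
    (((hu_cont.mono inter_subset_left).sub
      (continuous_const.mul (continuous_regPot hd hp hfi)).continuousOn).add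
      (by fun_prop))
  have hx₁D := hKD hx₁K
  have hgt : ε / 2 < u x₁ := by
    have h1 := hmax hx₀K
    simp only [mem_ofPred_eq] at h1
    have h2 : κ * ‖x₁‖ ^ 2 ≤ ε / 4 := by
      calc κ * ‖x₁‖ ^ 2 ≤ κ * C ^ 2 := by
            have := hC x₁ hx₁K.1
            gcongr
        _ = ε / 4 := by rw [hκ_def]; field_simp
    have h3 : 0 ≤ κ * ‖x₀‖ ^ 2 := by positivity
    have h4 := mul_nonneg hc.le (hw0 x₁)
    linarith
  have hKnhds : K ∈ nhds x₁ := by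
    have h1 := (hu.continuousOn.continuousAt (hDo.mem_nhds hx₁D)).eventually_const_lt hgt
    filter_upwards [h1, hDo.mem_nhds hx₁D] with y hy hyD
    exact ⟨subset_closure hyD, show ε / 2 ≤ u y from hy.le⟩
  have hineq := lapl_le_of_isLocalMax hd rfl hp hfi hDo hu hx₁D (hmax.isLocalMax hKnhds)
  have hball : ball x₁ ρ ⊆ D := fun y hy =>
    hthick (mem_thickening_iff.2 ⟨x₁, hx₁K, (mem_ball.1 hy).trans_le (min_le_right _ _)⟩)
  have hlow := le_integral_approxDelta (n := n) (by omega) hd hρ.le hfi hf0 hball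
    (m := max (f x₁ - κ) 0) (fun y hy => max_le (by
      have h1 : dist (f x₁) (f y) < κ := hunif
        ((dist_comm x₁ y).trans_lt ((mem_ball.1 hy).trans_le (min_le_left _ _))) hx₁K
      rw [Real.dist_eq] at h1
      linarith [(abs_lt.1 h1).2]) (hf0 y))
  set θ := ρ ^ n * (ρ ^ 2 + d) ^ (-n / 2 : ℝ)
  set I := ∫ y in D, d * (‖x₁ - y‖ ^ 2 + d) ^ (1 - n / 2 - 2 : ℝ) * f y
  have hcI : c * (2 * (1 - n / 2) * n * I) = -(I / ω) := by
    have : (n : ℝ) - 2 ≠ 0 := by linarith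
    rw [hc_def]
    field_simp
    ring
  rw [hcI] at hineq
  have hIω : max (f x₁ - κ) 0 * θ ≤ I / ω := by
    rw [le_div_iff₀ hω]
    linarith
  have hθ0 : 0 ≤ θ := by positivity
  have hlapl : -f x₁ ≤ lapl u x₁ := neg_abs_le _
  have hfM : f x₁ ≤ M := hlap x₁ hx₁D
  have hmain : f x₁ - 2 * κ ≤ max (f x₁ - κ) 0 * θ := by
    rcases le_total (f x₁ - κ) 0 with h | h
    · have : 0 ≤ max (f x₁ - κ) 0 * θ := by positivity
      linarith
    · rw [max_eq_left h]
      by_cases hθ1 : θ ≤ 1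
      · nlinarith
      · nlinarith
  nlinarith

/-- Brezis-Gallouet-Wainger type estimate, dimension `n ≥ 3`:
`‖u‖_∞ ≤ ((n-1)²+1)/(2n(n-2)ωₙ^{2/n}) ‖Δu‖₁^{2/n} ‖Δu‖_∞^{(n-2)/n} - ‖Δu‖₁/(n(n-2)ωₙ R^{n-2})`. -/
theorem linfty_bound_dim_ge_three
    (n : ℕ) (hn : 3 ≤ n) (D : Set (Euc n)) (hD : D.Nonempty) (hDo : IsOpen D)
    (hDb : Bornology.IsBounded D) (hDc : IsConnected D)
    (u : Euc n → ℝ)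
    (hu_cont : ContinuousOn u (closure D))
    (hu_smooth : ContDiffOn ℝ 2 u D)
    (hu_bdry : ∀ x ∈ frontier D, u x = 0)
    (hu_lap_bdd : ∃ M : ℝ, ∀ x ∈ D, |lapl u x| ≤ M)
    (hpos : 0 < ⨆ x ∈ D, |lapl u x|)
    (ωn R L1 Linf : ℝ)
    (hωn : ωn = (volume (ball (0 : Euc n) 1)).toReal)
    (hR : R = ((volume D).toReal / ωn) ^ ((1:ℝ)/(n:ℝ)))
    (hL1 : L1 = ∫ x in D, |lapl u x|)
    (hLinf : Linf = ⨆ x ∈ D, |lapl u x|) :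
    (⨆ x ∈ D, |u x|) ≤
      (((n:ℝ) - 1)^2 + 1) / (2 * (n:ℝ) * ((n:ℝ) - 2) * ωn ^ ((2:ℝ)/(n:ℝ))) *
          L1 ^ ((2:ℝ)/(n:ℝ)) * Linf ^ (((n:ℝ) - 2)/(n:ℝ))
        - L1 / ((n:ℝ) * ((n:ℝ) - 2) * ωn * R ^ ((n:ℝ) - 2)) := by
  have hn' : (3 : ℝ) ≤ n := by exact_mod_cast hn
  have hn0 : (n : ℝ) ≠ 0 := by linarith
  have hω : 0 < ωn := by
    rw [hωn]
    exact ENNReal.toReal_pos (measure_ball_pos _ _ one_pos).ne' measure_ball_lt_top.ne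
  have hM : 0 < Linf := hLinf ▸ hpos
  obtain ⟨B, hB⟩ := hu_lap_bdd
  have hlap : ∀ x ∈ D, |lapl u x| ≤ Linf := by
    intro x hx
    have hbdd : BddAbove (range fun x => ⨆ _ : x ∈ D, |lapl u x|) := by
      refine ⟨max B 0, ?_⟩
      rintro _ ⟨y, rfl⟩
      exact Real.iSup_le (fun hy => (hB y hy).trans (le_max_left _ _)) (le_max_right _ _)
    have h := le_ciSup hbdd x
    rw [← hLinf] at h
    simpa [hx] using h
  have hL1_nonneg : 0 ≤ L1 := hL1 ▸ integral_nonneg fun _ => abs_nonneg _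
  have hDfin : volume D < ⊤ := hDb.measure_lt_top
  have hDpos : 0 < volume.real D :=
    ENNReal.toReal_pos (hDo.measure_pos _ hD).ne' hDfin.ne
  have hL1_le : L1 ≤ Linf * volume.real D := by
    have h := norm_setIntegral_le_of_norm_le_const (f := fun x => |lapl u x|) hDfin
      (fun x hx => by simpa using hlap x hx)
    rw [← hL1] at h
    exact (le_abs_self _).trans h
  set r : ℝ := (L1 / (Linf * ωn)) ^ ((1 : ℝ) / n) with hr
  have hr0 : 0 ≤ r := by positivity
  have hrn : r ^ n = L1 / (Linf * ωn) := by
    rw [hr, one_div, Real.rpow_inv_natCast_pow (by positivity) (by omega)]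
  have hRpos : 0 < R := by
    rw [hR]
    exact Real.rpow_pos_of_pos (div_pos hDpos hω) _
  have hrR : r ≤ R := by
    rw [hr, hR]
    refine Real.rpow_le_rpow (by positivity) ?_ (by positivity)
    rw [div_le_div_iff₀ (by positivity) hω]
    calc L1 * ωn ≤ Linf * volume.real D * ωn := by gcongr
      _ = (volume D).toReal * (Linf * ωn) := by rw [measureReal_def]; ring
  have hL1_eq : L1 = Linf * ωn * r ^ n := by
    rw [hrn]
    field_simp
  have hmass : ∫ y in D, |lapl u y| = Linf * volume.real (ball (0 : Euc n) 1) * r ^ n := by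
    rw [measureReal_def, ← hωn, ← hL1, hL1_eq]
  have hpt : ∀ x ∈ D, |u x| ≤ Linf * r ^ 2 / (2 * (n - 2)) := by
    intro x hx
    refine abs_le'.2 ⟨le_of_lapl_mass hn hDo hDb hu_cont hu_smooth hu_bdry hM.le hr0 hlap hmass hx,
      le_of_lapl_mass (u := fun y => -u y) hn hDo hDb hu_cont.neg hu_smooth.neg
        (fun y hy => by simp [hu_bdry y hy]) hM.le hr0 (fun y hy => ?_) ?_ hx⟩
    · rw [lapl_neg, abs_neg]
      exact hlap y hy
    · simpa only [lapl_neg, abs_neg] using hmass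
  have hmain : Linf * r ^ 2 =
      L1 ^ ((2 : ℝ) / n) * Linf ^ (((n : ℝ) - 2) / n) / ωn ^ ((2 : ℝ) / n) := by
    have h2 : r ^ 2 = (L1 / (Linf * ωn)) ^ ((2 : ℝ) / n) := by
      rw [hr, ← Real.rpow_natCast, ← Real.rpow_mul (by positivity)]
      congr 1
      push_cast
      ring
    have h3 : Linf ^ (((n : ℝ) - 2) / n) = Linf / Linf ^ ((2 : ℝ) / n) := by
      rw [show ((n : ℝ) - 2) / n = 1 - 2 / n by field_simp, Real.rpow_sub hM, Real.rpow_one]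
    rw [h2, h3, Real.div_rpow hL1_nonneg (by positivity), Real.mul_rpow hM.le hω.le]
    field_simp
  have hneg : L1 / ((n : ℝ) * ((n : ℝ) - 2) * ωn * R ^ ((n : ℝ) - 2)) ≤
      Linf * r ^ 2 / (n * (n - 2)) := by
    have hR2 : R ^ ((n : ℝ) - 2) = R ^ (n - 2) := by
      rw [← Real.rpow_natCast, Nat.cast_sub (by omega)]
      norm_num
    have hpow : r ^ (n - 2) ≤ R ^ (n - 2) := by gcongr
    have hn2 : (0 : ℝ) < n - 2 := by linarith
    rw [hR2, hL1_eq, div_le_div_iff₀ (by positivity) (by positivity),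
      show r ^ n = r ^ (n - 2) * r ^ 2 by rw [← pow_add]; congr 1; omega]
    have h := mul_le_mul_of_nonneg_left hpow
      (by positivity : 0 ≤ Linf * r ^ 2 * ωn * (n * ((n : ℝ) - 2)))
    linarith
  have hcoef : Linf * r ^ 2 / (2 * (n - 2)) + Linf * r ^ 2 / (n * (n - 2)) ≤
      (((n : ℝ) - 1) ^ 2 + 1) / (2 * n * (n - 2)) * (Linf * r ^ 2) := by
    have hn2 : (0 : ℝ) < n - 2 := by linarith
    have hk : 1 / (2 * ((n : ℝ) - 2)) + 1 / (n * (n - 2)) ≤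
        (((n : ℝ) - 1) ^ 2 + 1) / (2 * n * (n - 2)) := by
      rw [show 1 / (2 * ((n : ℝ) - 2)) + 1 / (n * (n - 2)) = (n + 2) / (2 * n * (n - 2)) by
        field_simp]
      exact div_le_div_of_nonneg_right (by nlinarith) (by positivity)
    have h := mul_le_mul_of_nonneg_right hk (by positivity : 0 ≤ Linf * r ^ 2)
    refine le_trans (le_of_eq ?_) h
    ring
  have hfinal : Linf * r ^ 2 / (2 * (n - 2)) ≤
      (((n:ℝ) - 1)^2 + 1) / (2 * (n:ℝ) * ((n:ℝ) - 2) * ωn ^ ((2:ℝ)/(n:ℝ))) *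
          L1 ^ ((2:ℝ)/(n:ℝ)) * Linf ^ (((n:ℝ) - 2)/(n:ℝ))
        - L1 / ((n:ℝ) * ((n:ℝ) - 2) * ωn * R ^ ((n:ℝ) - 2)) := by
    have e : (((n:ℝ) - 1)^2 + 1) / (2 * (n:ℝ) * ((n:ℝ) - 2) * ωn ^ ((2:ℝ)/(n:ℝ))) *
          L1 ^ ((2:ℝ)/(n:ℝ)) * Linf ^ (((n:ℝ) - 2)/(n:ℝ)) =
        (((n : ℝ) - 1) ^ 2 + 1) / (2 * n * (n - 2)) * (Linf * r ^ 2) := by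
      rw [hmain, div_mul_eq_div_div]
      ring
    rw [e]
    linarith
  have hbound : 0 ≤ Linf * r ^ 2 / (2 * ((n : ℝ) - 2)) :=
    div_nonneg (by positivity) (by linarith)
  exact (Real.iSup_le (fun x => Real.iSup_le (fun hx => hpt x hx) hbound) hbound).trans hfinal
end
end

section
/- Let n ≥ 3, let D be a nonempty bounded open connected subset of ℝⁿ, and let λ > 0. Suppose u is continuous on the closure of D, twice continuously differentiable on D, vanishes at every point of ∂D, and satisfies the eigenvalue equation −Δu(x) = λ u(x) for all x ∈ D. Then sup_{x∈D} |u(x)| ≤ (2/(nⁿ (n−2) ω_n)) · [ λ^{n/2} ((n−1)² + 1)^{n/2} − λ n^{n−1} / R^{n−2} ] · ‖u‖₁, where R = (|D|/ω_n)^{1/n}. -/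
open MeasureTheory Set Metric Filter

noncomputable section

open scoped Topology

/-- Second-order necessary condition for a local minimum. -/
lemma IsLocalMin.nonneg_of_hasDerivAt_hasDerivAt {f f' : ℝ → ℝ} {a b : ℝ} (hmin : IsLocalMin f a)
    (h1 : ∀ᶠ t in 𝓝 a, HasDerivAt f (f' t) t) (h2 : HasDerivAt f' b a) : 0 ≤ b := by
  by_contra! hb
  have hd : deriv f =ᶠ[𝓝 a] f' := h1.mono fun t ht => ht.deriv
  have hdd : deriv (deriv f) a = b := by rw [hd.deriv_eq, h2.deriv]
  have hmax : IsLocalMax f a :=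
    isLocalMax_of_deriv_deriv_neg (hdd ▸ hb) hmin.deriv_eq_zero h1.self_of_nhds.continuousAt
  have hconst : f =ᶠ[𝓝 a] fun _ => f a := by
    filter_upwards [hmin, hmax] with t h h' using le_antisymm h' h
  have : deriv f =ᶠ[𝓝 a] fun _ => 0 := by
    simpa using hconst.deriv
  rw [this.deriv_eq, deriv_const] at hdd
  exact hb.ne hdd.symm

/-- Differentiation of a convolution along a line. -/
lemma hasDerivAt_integral_comp_sub_mul {n : ℕ} {k k' V : Euc n → ℝ} {e : Euc n} {C C' : ℝ}
    (hk : Continuous k) (hk' : Continuous k') (hC : ∀ z, |k z| ≤ C) (hC' : ∀ z, |k' z| ≤ C')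
    (hd : ∀ z, HasDerivAt (fun t : ℝ => k (z + t • e)) (k' z) 0) (hV : Integrable V) (x : Euc n) :
    HasDerivAt (fun t : ℝ => ∫ y, k (x + t • e - y) * V y) (∫ y, k' (x - y) * V y) 0 := by
  have key := (hasDerivAt_integral_of_dominated_loc_of_deriv_le (μ := (volume : Measure (Euc n)))
    (F := fun (t : ℝ) y => k (x + t • e - y) * V y)
    (F' := fun (t : ℝ) y => k' (x + t • e - y) * V y) (x₀ := 0) (s := univ)
    (bound := fun y => C' * ‖V y‖) univ_mem ?_ ?_ ?_ ?_ ?_ ?_).2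
  · simpa using key
  · exact .of_forall fun t => (hk.comp (by fun_prop)).aestronglyMeasurable.mul
      hV.aestronglyMeasurable
  · exact hV.bdd_mul (c := C) (hk.comp (by fun_prop)).aestronglyMeasurable
      (.of_forall fun y => hC _)
  · exact (hk'.comp (by fun_prop)).aestronglyMeasurable.mul hV.aestronglyMeasurable
  · refine .of_forall fun y t _ => ?_
    rw [norm_mul]
    exact mul_le_mul_of_nonneg_right (hC' _) (norm_nonneg _)
  · exact hV.norm.const_mul _
  · refine .of_forall fun y t _ => HasDerivAt.mul_const ?_ _
    have h := hd (x + t • e - y)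
    rw [← sub_self t] at h
    refine (HasDerivAt.comp_sub_const t t h).congr_of_eventuallyEq (.of_forall fun r => ?_)
    change k (x + r • e - y) = k (x + t • e - y + (r - t) • e)
    congr 1
    module

lemma norm_add_smul_single_sq {n : ℕ} (z : Euc n) (i : Fin n) (t : ℝ) :
    ‖z + t • (EuclideanSpace.single i 1 : Euc n)‖ ^ 2 = ‖z‖ ^ 2 + 2 * t * z i + t ^ 2 := by
  rw [norm_add_sq_real, inner_smul_right, norm_smul, EuclideanSpace.inner_single_right]
  simp
  ring

/-- First derivative, along a coordinate line, of a power of `‖z‖² + ε²`. -/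
lemma hasDerivAt_norm_sq_add_rpow {n : ℕ} {ε : ℝ} (hε : 0 < ε) (p : ℝ) (i : Fin n) (z : Euc n) :
    HasDerivAt (fun t : ℝ => (‖z + t • (EuclideanSpace.single i 1 : Euc n)‖ ^ 2 + ε ^ 2) ^ p)
      (2 * p * z i * (‖z‖ ^ 2 + ε ^ 2) ^ (p - 1)) 0 := by
  simp_rw [norm_add_smul_single_sq]
  have h : HasDerivAt (fun t : ℝ => ‖z‖ ^ 2 + 2 * t * z i + t ^ 2 + ε ^ 2) (2 * z i) 0 := by
    have h1 := ((((hasDerivAt_id (0 : ℝ)).const_mul 2).mul_const (z i)).const_add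
      (‖z‖ ^ 2)).add ((hasDerivAt_id (0 : ℝ)).pow 2)
    simpa using h1.add_const (ε ^ 2)
  have hpos : ‖z‖ ^ 2 + 2 * (0 : ℝ) * z i + 0 ^ 2 + ε ^ 2 ≠ 0 := by
    have : 0 < ‖z‖ ^ 2 + ε ^ 2 := by positivity
    simpa using this.ne'
  have key := h.rpow_const (p := p) (Or.inl hpos)
  simp only [mul_zero, zero_mul, add_zero, ne_eq, OfNat.ofNat_ne_zero, not_false_eq_true,
    zero_pow] at key
  exact key.congr_deriv (by ring)

/-- Second derivative, along a coordinate line, of a power of `‖z‖² + ε²`. -/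
lemma hasDerivAt_coord_mul_norm_sq_add_rpow {n : ℕ} {ε : ℝ} (hε : 0 < ε) (p : ℝ) (i : Fin n)
    (z : Euc n) :
    HasDerivAt (fun t : ℝ => 2 * p * (z + t • (EuclideanSpace.single i 1 : Euc n)) i *
        (‖z + t • (EuclideanSpace.single i 1 : Euc n)‖ ^ 2 + ε ^ 2) ^ (p - 1))
      (2 * p * (‖z‖ ^ 2 + ε ^ 2) ^ (p - 1) +
        4 * p * (p - 1) * z i ^ 2 * (‖z‖ ^ 2 + ε ^ 2) ^ (p - 2)) 0 := by
  have h1 : HasDerivAt (fun t : ℝ => 2 * p * (z + t • (EuclideanSpace.single i 1 : Euc n)) i)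
      (2 * p) 0 := by
    simpa using ((hasDerivAt_id (0 : ℝ)).const_add (z i)).const_mul (2 * p)
  refine (h1.mul (hasDerivAt_norm_sq_add_rpow hε (p - 1) i z)).congr_deriv ?_
  rw [show p - 1 - 1 = p - 2 by ring, zero_smul, add_zero]
  ring

lemma norm_sq_add_rpow_le {n : ℕ} {ε p : ℝ} (hε : 0 < ε) (hp : p ≤ 0) (z : Euc n) :
    (‖z‖ ^ 2 + ε ^ 2) ^ p ≤ (ε ^ 2) ^ p :=
  Real.rpow_le_rpow_of_nonpos (by positivity) (by nlinarith [sq_nonneg ‖z‖]) hp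

lemma coord_sq_le {n : ℕ} (z : Euc n) (i : Fin n) : z i ^ 2 ≤ ‖z‖ ^ 2 := by
  rw [EuclideanSpace.norm_sq_eq]
  have := Finset.single_le_sum (f := fun i => ‖z i‖ ^ 2) (fun j _ => sq_nonneg _)
    (Finset.mem_univ i)
  simpa using this

lemma continuous_norm_sq_add_rpow {n : ℕ} {ε : ℝ} (hε : 0 < ε) (p : ℝ) :
    Continuous fun z : Euc n => (‖z‖ ^ 2 + ε ^ 2) ^ p :=
  Continuous.rpow_const (by fun_prop) fun z => Or.inl (by positivity)

lemma abs_coord_mul_rpow_le {n : ℕ} {ε p : ℝ} (hε : 0 < ε) (hp : p ≤ 0) (i : Fin n) (z : Euc n) :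
    |2 * p * z i * (‖z‖ ^ 2 + ε ^ 2) ^ (p - 1)| ≤
      |2 * p| * ((ε ^ 2) ^ (p - 1) + (ε ^ 2) ^ p) := by
  have hpos : 0 < ‖z‖ ^ 2 + ε ^ 2 := by positivity
  have hr := Real.rpow_pos_of_pos hpos (p - 1)
  rw [mul_assoc, abs_mul]
  refine mul_le_mul_of_nonneg_left ?_ (abs_nonneg _)
  rw [abs_mul, abs_of_pos hr]
  have h1 : |z i| ≤ 1 + (‖z‖ ^ 2 + ε ^ 2) := by
    have := coord_sq_le z i
    rw [← sq_abs] at this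
    nlinarith [sq_nonneg (|z i| - 1), sq_nonneg ε]
  have h2 : (‖z‖ ^ 2 + ε ^ 2) * (‖z‖ ^ 2 + ε ^ 2) ^ (p - 1) = (‖z‖ ^ 2 + ε ^ 2) ^ p := by
    rw [Real.rpow_sub_one hpos.ne']
    field_simp
  calc |z i| * (‖z‖ ^ 2 + ε ^ 2) ^ (p - 1)
      ≤ (1 + (‖z‖ ^ 2 + ε ^ 2)) * (‖z‖ ^ 2 + ε ^ 2) ^ (p - 1) :=
        mul_le_mul_of_nonneg_right h1 hr.le
    _ = (‖z‖ ^ 2 + ε ^ 2) ^ (p - 1) + (‖z‖ ^ 2 + ε ^ 2) ^ p := by rw [add_mul, h2, one_mul]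
    _ ≤ _ := add_le_add (norm_sq_add_rpow_le hε (by linarith) z) (norm_sq_add_rpow_le hε hp z)

lemma abs_second_coord_deriv_le {n : ℕ} {ε p : ℝ} (hε : 0 < ε) (hp : p ≤ 0) (i : Fin n)
    (z : Euc n) :
    |2 * p * (‖z‖ ^ 2 + ε ^ 2) ^ (p - 1) +
        4 * p * (p - 1) * z i ^ 2 * (‖z‖ ^ 2 + ε ^ 2) ^ (p - 2)| ≤
      (|2 * p| + |4 * p * (p - 1)|) * (ε ^ 2) ^ (p - 1) := by
  have hpos : 0 < ‖z‖ ^ 2 + ε ^ 2 := by positivity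
  have hr := Real.rpow_pos_of_pos hpos (p - 1)
  have hr2 := Real.rpow_pos_of_pos hpos (p - 2)
  have h2 : (‖z‖ ^ 2 + ε ^ 2) * (‖z‖ ^ 2 + ε ^ 2) ^ (p - 2) = (‖z‖ ^ 2 + ε ^ 2) ^ (p - 1) := by
    rw [show p - 2 = p - 1 - 1 by ring, Real.rpow_sub_one hpos.ne' (p - 1)]
    field_simp
  have h3 := norm_sq_add_rpow_le hε (show p - 1 ≤ 0 by linarith) z
  have h4 : z i ^ 2 * (‖z‖ ^ 2 + ε ^ 2) ^ (p - 2) ≤ (ε ^ 2) ^ (p - 1) := by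
    refine le_trans ?_ h3
    rw [← h2]
    exact mul_le_mul_of_nonneg_right (by nlinarith [coord_sq_le z i, sq_nonneg ε]) hr2.le
  refine (abs_add_le _ _).trans ?_
  rw [add_mul, abs_mul (2 * p), mul_assoc (4 * p * (p - 1)), abs_mul (4 * p * (p - 1)),
    abs_of_pos hr, abs_of_nonneg (show 0 ≤ z i ^ 2 * (‖z‖ ^ 2 + ε ^ 2) ^ (p - 2) by positivity)]
  exact add_le_add (mul_le_mul_of_nonneg_left h3 (abs_nonneg _))
    (mul_le_mul_of_nonneg_left h4 (abs_nonneg _))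

lemma hasDerivAt_line_of_contDiffOn {n : ℕ} {D : Set (Euc n)} (hDo : IsOpen D) {u : Euc n → ℝ}
    (hu : ContDiffOn ℝ 2 u D) {x : Euc n} (hx : x ∈ D) (e : Euc n) :
    (∀ᶠ t : ℝ in 𝓝 0, HasDerivAt (fun t : ℝ => u (x + t • e)) (fderiv ℝ u (x + t • e) e) t) ∧
      HasDerivAt (fun t : ℝ => fderiv ℝ u (x + t • e) e)
        (fderiv ℝ (fun y => fderiv ℝ u y e) x e) 0 := by
  have hline : ∀ t : ℝ, HasDerivAt (fun t : ℝ => x + t • e) e t := fun t => by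
    simpa using ((hasDerivAt_id t).smul_const e).const_add x
  constructor
  · have hmem : ∀ᶠ t : ℝ in 𝓝 0, x + t • e ∈ D := by
      apply (hline 0).continuousAt.eventually_mem
      simpa using hDo.mem_nhds hx
    filter_upwards [hmem] with t ht
    have hdu : DifferentiableAt ℝ u (x + t • e) :=
      (hu.contDiffAt (hDo.mem_nhds ht)).differentiableAt (by norm_num)
    exact hdu.hasFDerivAt.comp_hasDerivAt t (hline t)
  · have h1 : ContDiffAt ℝ 1 (fderiv ℝ u) x :=
      (hu.contDiffAt (hDo.mem_nhds hx)).fderiv_right (by norm_num)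
    have h2 : DifferentiableAt ℝ (fun y => fderiv ℝ u y e) x :=
      (h1.differentiableAt (by norm_num)).clm_apply (differentiableAt_const e)
    have h3 := h2.hasFDerivAt
    rw [show x = x + (0 : ℝ) • e by simp] at h3
    have h4 := h3.comp_hasDerivAt 0 (hline 0)
    simp only [zero_smul, add_zero] at h4
    exact h4

/-- Comparison with a supersolution: if `-Δw ≥ λ|u| - nδ` in `D` and `w ≥ 0`, then
`-u ≤ w + δB²` in `D`. -/
lemma neg_le_of_supersolution {n : ℕ} (hn : 0 < n) {D : Set (Euc n)} (hDo : IsOpen D)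
    (hDb : Bornology.IsBounded D) {lam : ℝ} (hlam : 0 < lam) {u : Euc n → ℝ}
    (hu_cont : ContinuousOn u (closure D)) (hu_smooth : ContDiffOn ℝ 2 u D)
    (hu_bdry : ∀ x ∈ frontier D, u x = 0) (hu_eig : ∀ x ∈ D, -lapl u x = lam * u x)
    {w : Euc n → ℝ} {w₁ w₂ : Fin n → Euc n → ℝ} (hw : Continuous w) (hw0 : ∀ x, 0 ≤ w x)
    (hw₁ : ∀ i x, HasDerivAt (fun t : ℝ => w (x + t • EuclideanSpace.single i 1)) (w₁ i x) 0)
    (hw₂ : ∀ i x, HasDerivAt (fun t : ℝ => w₁ i (x + t • EuclideanSpace.single i 1)) (w₂ i x) 0)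
    {δ B : ℝ} (hδ : 0 < δ) (hB : ∀ x ∈ closure D, ‖x‖ ^ 2 ≤ B)
    (hlap : ∀ x ∈ D, ∑ i, w₂ i x ≤ -(lam * |u x|) + n * δ) {x : Euc n} (hx : x ∈ D) :
    -u x ≤ w x + δ * B := by
  set f : Euc n → ℝ := fun x => w x + δ * (B - ‖x‖ ^ 2) + u x with hf
  have hfc : ContinuousOn f (closure D) := by
    refine ContinuousOn.add (Continuous.continuousOn (by fun_prop)) hu_cont
  obtain ⟨x₀, hx₀, hmin⟩ := hDb.isCompact_closure.exists_isMinOn ⟨x, subset_closure hx⟩ hfc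
  suffices h0 : 0 ≤ f x₀ by
    have h1 : f x₀ ≤ f x := hmin (subset_closure hx)
    simp only [hf] at h0 h1
    nlinarith [sq_nonneg ‖x‖]
  by_cases hxD : x₀ ∈ D
  · exfalso
    have hsecond : ∀ i : Fin n, 0 ≤ w₂ i x₀ + δ * (-2) +
        fderiv ℝ (fun y => fderiv ℝ u y (EuclideanSpace.single i 1)) x₀
          (EuclideanSpace.single i 1) := by
      intro i
      set e : Euc n := EuclideanSpace.single i 1 with he
      obtain ⟨hu1, hu2⟩ := hasDerivAt_line_of_contDiffOn hDo hu_smooth hxD e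
      have hw1' : ∀ t : ℝ, HasDerivAt (fun t : ℝ => w (x₀ + t • e)) (w₁ i (x₀ + t • e)) t := by
        intro t
        have h := hw₁ i (x₀ + t • e)
        rw [← sub_self t] at h
        refine (HasDerivAt.comp_sub_const t t h).congr_of_eventuallyEq (.of_forall fun r => ?_)
        change w (x₀ + r • e) = w (x₀ + t • e + (r - t) • e)
        congr 1
        module
      have hq : ∀ t : ℝ, HasDerivAt (fun t : ℝ => δ * (B - ‖x₀ + t • e‖ ^ 2))
          (δ * (-(2 * x₀ i + 2 * t))) t := by
        intro t
        simp_rw [he, norm_add_smul_single_sq]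
        refine HasDerivAt.const_mul δ (HasDerivAt.const_sub B ?_)
        have h1 := ((((hasDerivAt_id t).const_mul 2).mul_const (x₀ i)).const_add
          (‖x₀‖ ^ 2)).add ((hasDerivAt_id t).pow 2)
        exact h1.congr_deriv (by simp)
      have hq2 : HasDerivAt (fun t : ℝ => δ * (-(2 * x₀ i + 2 * t))) (δ * (-2)) 0 := by
        have h1 := ((((hasDerivAt_id (0 : ℝ)).const_mul 2).const_add (2 * x₀ i)).neg).const_mul δ
        exact h1.congr_deriv (by simp)
      have hloc : IsLocalMin (fun t : ℝ => w (x₀ + t • e) + δ * (B - ‖x₀ + t • e‖ ^ 2) +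
          u (x₀ + t • e)) 0 := by
        have hnear : ∀ᶠ y in 𝓝 x₀, f x₀ ≤ f y :=
          Filter.mem_of_superset (hDo.mem_nhds hxD) fun y hy => hmin (subset_closure hy)
        have hcont : ContinuousAt (fun t : ℝ => x₀ + t • e) 0 := by fun_prop
        rw [show x₀ = x₀ + (0 : ℝ) • e by simp] at hnear
        exact hcont.eventually hnear
      refine hloc.nonneg_of_hasDerivAt_hasDerivAt
        (hu1.mono fun t ht => ((hw1' t).add (hq t)).add ht) ?_
      exact ((hw₂ i x₀).add hq2).add hu2
    have hsum := Finset.sum_nonneg fun i (_ : i ∈ Finset.univ) => hsecond i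
    rw [Finset.sum_add_distrib, Finset.sum_add_distrib] at hsum
    have hl : lapl u x₀ = -(lam * u x₀) := by rw [← hu_eig x₀ hxD, neg_neg]
    rw [lapl] at hl
    rw [hl] at hsum
    have h1 := hlap x₀ hxD
    have h2 := mul_le_mul_of_nonneg_left (neg_abs_le (u x₀)) hlam.le
    have h3 : (0 : ℝ) < n * δ := by positivity
    simp only [Finset.sum_const, Finset.card_univ, Fintype.card_fin, nsmul_eq_mul] at hsum
    linarith
  · have hfr : x₀ ∈ frontier D := by rw [hDo.frontier_eq]; exact ⟨hx₀, hxD⟩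
    simp only [hf, hu_bdry x₀ hfr, add_zero]
    have := hB x₀ hx₀
    have := hw0 x₀
    have : 0 ≤ δ * (B - ‖x₀‖ ^ 2) := mul_nonneg hδ.le (by linarith)
    linarith

/-- Mass, in a ball, of the regularised Dirac mass at scale `ε`. -/
lemma setIntegral_ball_regularised_dirac {n : ℕ} (hn : 0 < n) {δ ε : ℝ} (hδ : 0 < δ)
    (hε : 0 < ε) :
    ∫ z in ball (0 : Euc n) δ, ε ^ 2 * (‖z‖ ^ 2 + ε ^ 2) ^ (-((n : ℝ) + 2) / 2) =
      (volume : Measure (Euc n)).real (ball 0 1) * (δ ^ n * (δ ^ 2 + ε ^ 2) ^ (-(n : ℝ) / 2)) := by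
  have : Nonempty (Fin n) := ⟨⟨0, hn⟩⟩
  have : Nontrivial (Euc n) := inferInstance
  set φ : ℝ → ℝ := fun y => ε ^ 2 * (y ^ 2 + ε ^ 2) ^ (-((n : ℝ) + 2) / 2) with hφ
  have hpos : ∀ y : ℝ, 0 < y ^ 2 + ε ^ 2 := fun y => by positivity
  have hφc : Continuous φ := continuous_const.mul
    (Continuous.rpow_const (by fun_prop) fun y => Or.inl (hpos y).ne')
  have h1 : ∫ z in ball (0 : Euc n) δ, φ ‖z‖ = ∫ z : Euc n, (Iio δ).indicator φ ‖z‖ := by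
    rw [← integral_indicator measurableSet_ball]
    congr 1
    ext z
    simp [indicator]
  rw [h1, integral_fun_norm_addHaar, finrank_euclideanSpace_fin]
  have h2 : ∫ y in Ioi (0 : ℝ), y ^ (n - 1) • (Iio δ).indicator φ y =
      ∫ y in (0 : ℝ)..δ, y ^ (n - 1) * φ y := by
    have : (fun y : ℝ => y ^ (n - 1) • (Iio δ).indicator φ y) =
        (Iio δ).indicator (fun y => y ^ (n - 1) * φ y) := by
      ext y
      by_cases hy : y < δ <;> simp [indicator, hy]
    rw [this, setIntegral_indicator measurableSet_Iio, Ioi_inter_Iio,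
      intervalIntegral.integral_of_le hδ.le, integral_Ioc_eq_integral_Ioo]
  have hderiv : ∀ y : ℝ, HasDerivAt
      (fun y : ℝ => (1 / n : ℝ) * (y ^ n * (y ^ 2 + ε ^ 2) ^ (-(n : ℝ) / 2)))
      (y ^ (n - 1) * φ y) y := by
    intro y
    have ha := hasDerivAt_pow n y
    have hb := ((hasDerivAt_pow 2 y).add_const (ε ^ 2)).rpow_const (p := -(n : ℝ) / 2)
      (Or.inl (hpos y).ne')
    refine ((ha.mul hb).const_mul (1 / n : ℝ)).congr_deriv ?_
    have hn0 : (n : ℝ) ≠ 0 := by positivity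
    have e1 : (y ^ 2 + ε ^ 2) ^ (-(n : ℝ) / 2) =
        (y ^ 2 + ε ^ 2) * (y ^ 2 + ε ^ 2) ^ (-((n : ℝ) + 2) / 2) := by
      rw [show -(n : ℝ) / 2 = 1 + -((n : ℝ) + 2) / 2 by ring, Real.rpow_add (hpos y),
        Real.rpow_one]
    have e2 : -(n : ℝ) / 2 - 1 = -((n : ℝ) + 2) / 2 := by ring
    have e3 : y ^ n = y * y ^ (n - 1) := by rw [← pow_succ', Nat.sub_add_cancel hn]
    rw [e2, e1, hφ, e3]
    field_simp
    push_cast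
    ring
  rw [h2, intervalIntegral.integral_eq_sub_of_hasDerivAt (fun y _ => hderiv y)
    (by apply Continuous.intervalIntegrable; fun_prop)]
  have hn0 : (n : ℝ) ≠ 0 := by positivity
  simp only [nsmul_eq_mul, smul_eq_mul, zero_pow hn.ne', zero_mul, mul_zero, sub_zero]
  field_simp

/-- The regularised Dirac masses convolved with `V` are eventually at least `V - η`, uniformly. -/
lemma exists_sub_le_integral_regularised_dirac {n : ℕ} (hn : 0 < n) {V : Euc n → ℝ} {M : ℝ}
    (hVu : UniformContinuous V) (hV : Integrable V) (hV0 : ∀ x, 0 ≤ V x) (hVM : ∀ x, V x ≤ M)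
    {η : ℝ} (hη : 0 < η) :
    ∃ ε : ℝ, 0 < ε ∧ ∀ x, (volume : Measure (Euc n)).real (ball 0 1) * (V x - η) ≤
      ∫ y, ε ^ 2 * (‖x - y‖ ^ 2 + ε ^ 2) ^ (-((n : ℝ) + 2) / 2) * V y := by
  set ω := (volume : Measure (Euc n)).real (ball 0 1) with hω
  have hω0 : 0 ≤ ω := measureReal_nonneg
  obtain ⟨δ, hδ, hVδ⟩ := Metric.uniformContinuous_iff.1 hVu (η / 2) (by positivity)
  have hM : 0 ≤ M := (hV0 0).trans (hVM 0)
  have hlim : Tendsto (fun ε : ℝ => M * (1 - δ ^ n * (δ ^ 2 + ε ^ 2) ^ (-(n : ℝ) / 2)))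
      (𝓝[>] 0) (𝓝 0) := by
    have hc : ContinuousAt
        (fun ε : ℝ => M * (1 - δ ^ n * (δ ^ 2 + ε ^ 2) ^ (-(n : ℝ) / 2))) 0 := by
      refine ContinuousAt.mul continuousAt_const (ContinuousAt.sub continuousAt_const
        (ContinuousAt.mul continuousAt_const (ContinuousAt.rpow_const (by fun_prop) ?_)))
      left; positivity
    have h0 : M * (1 - δ ^ n * (δ ^ 2 + (0 : ℝ) ^ 2) ^ (-(n : ℝ) / 2)) = 0 := by
      have : (δ ^ 2 + (0 : ℝ) ^ 2) ^ (-(n : ℝ) / 2) = (δ ^ n)⁻¹ := by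
        rw [zero_pow two_ne_zero, add_zero, ← Real.rpow_natCast δ 2, ← Real.rpow_mul hδ.le,
          ← Real.rpow_natCast δ n, ← Real.rpow_neg hδ.le]
        congr 1
        push_cast
        ring
      rw [this, mul_inv_cancel₀ (by positivity), sub_self, mul_zero]
    have := hc.tendsto
    rw [h0] at this
    exact this.mono_left nhdsWithin_le_nhds
  obtain ⟨ε, hεM, hε⟩ := ((hlim.eventually_lt_const (show 0 < η / 2 by positivity)).and
    self_mem_nhdsWithin).exists
  have hε : 0 < ε := hε
  refine ⟨ε, hε, fun x => ?_⟩
  set ψ : Euc n → ℝ := fun z => ε ^ 2 * (‖z‖ ^ 2 + ε ^ 2) ^ (-((n : ℝ) + 2) / 2) with hψ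
  have hψ0 : ∀ z, 0 ≤ ψ z := fun z => by positivity
  have hψc : Continuous ψ := continuous_const.mul (continuous_norm_sq_add_rpow hε _)
  have hψb : ∀ z, ‖ψ z‖ ≤ ε ^ 2 * (ε ^ 2) ^ (-((n : ℝ) + 2) / 2) := fun z => by
    rw [Real.norm_of_nonneg (hψ0 z)]
    refine mul_le_mul_of_nonneg_left (norm_sq_add_rpow_le hε ?_ z) (by positivity)
    have : (0 : ℝ) ≤ n := Nat.cast_nonneg n
    linarith
  have hψV : Integrable fun y => ψ (x - y) * V y :=
    hV.bdd_mul (hψc.comp (by fun_prop)).aestronglyMeasurable (.of_forall fun y => hψb _)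
  have hR0 : 0 ≤ ∫ y, ψ (x - y) * V y :=
    integral_nonneg fun y => mul_nonneg (hψ0 _) (hV0 y)
  rcases le_or_gt (V x) η with hVx | hVx
  · exact (mul_nonpos_of_nonneg_of_nonpos hω0 (by linarith)).trans hR0
  set m := δ ^ n * (δ ^ 2 + ε ^ 2) ^ (-(n : ℝ) / 2) with hm
  have hm1 : m ≤ 1 := by
    have h1 : (δ ^ 2 + ε ^ 2) ^ (-(n : ℝ) / 2) ≤ (δ ^ 2) ^ (-(n : ℝ) / 2) :=
      Real.rpow_le_rpow_of_nonpos (by positivity) (by nlinarith)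
        (by have : (0 : ℝ) ≤ n := Nat.cast_nonneg n
            linarith)
    have h2 : (δ ^ 2) ^ (-(n : ℝ) / 2) = (δ ^ n)⁻¹ := by
      rw [← Real.rpow_natCast δ 2, ← Real.rpow_mul hδ.le,
          ← Real.rpow_natCast δ n, ← Real.rpow_neg hδ.le]
      congr 1
      push_cast
      ring
    calc m ≤ δ ^ n * (δ ^ n)⁻¹ := mul_le_mul_of_nonneg_left (h2 ▸ h1) (by positivity)
      _ = 1 := mul_inv_cancel₀ (by positivity)
  have hball : ∫ y in ball x δ, ψ (x - y) = ω * m := by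
    rw [← setIntegral_ball_regularised_dirac hn hδ hε, ← integral_indicator measurableSet_ball,
      ← integral_indicator measurableSet_ball,
      ← integral_sub_left_eq_self ((ball (0 : Euc n) δ).indicator _) volume x]
    congr 1
    ext y
    simp only [indicator, mem_ball, hψ, dist_comm y x, dist_eq_norm, sub_zero]
  have hbint : IntegrableOn (fun y => ψ (x - y)) (ball x δ) := by
    refine ((hψc.comp (by fun_prop : Continuous fun y => x - y)).continuousOn.integrableOn_compact
      (isCompact_closedBall x δ)).mono_set ball_subset_closedBall
  calc ω * (V x - η) ≤ ω * m * (V x - η / 2) := by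
        rw [mul_assoc]
        refine mul_le_mul_of_nonneg_left ?_ hω0
        nlinarith [hVM x, mul_nonneg (sub_nonneg.2 hm1) (sub_nonneg.2 (hVM x)),
          mul_nonneg (sub_nonneg.2 hm1) hη.le]
    _ = ∫ y in ball x δ, ψ (x - y) * (V x - η / 2) := by
        rw [integral_mul_const, hball]
    _ ≤ ∫ y in ball x δ, ψ (x - y) * V y := by
        refine setIntegral_mono_on (hbint.mul_const _) hψV.integrableOn measurableSet_ball
          fun y hy => mul_le_mul_of_nonneg_left ?_ (hψ0 _)
        have := hVδ (show dist y x < δ from hy)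
        rw [Real.dist_eq, abs_lt] at this
        linarith
    _ ≤ ∫ y, ψ (x - y) * V y :=
        setIntegral_le_integral hψV (.of_forall fun y => mul_nonneg (hψ0 _) (hV0 y))

/-- The truncated Newtonian kernel `(|z|^{2-n} - r^{2-n})⁺` is integrable, with explicit mass. -/
lemma integral_truncated_newton {n : ℕ} (hn : 3 ≤ n) {r : ℝ} (hr : 0 < r) :
    Integrable (fun z : Euc n =>
        (Iio r).indicator (fun y : ℝ => (y ^ (n - 2))⁻¹ - (r ^ (n - 2))⁻¹) ‖z‖) ∧
      ∫ z : Euc n, (Iio r).indicator (fun y : ℝ => (y ^ (n - 2))⁻¹ - (r ^ (n - 2))⁻¹) ‖z‖ =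
        n * (volume : Measure (Euc n)).real (ball 0 1) * (r ^ 2 / 2 - r ^ 2 / n) := by
  have : Nonempty (Fin n) := ⟨⟨0, by omega⟩⟩
  have : Nontrivial (Euc n) := inferInstance
  have hn0 : (n : ℝ) ≠ 0 := by
    have : 0 < n := by omega
    positivity
  have heq : EqOn (fun y : ℝ => y ^ (n - 1) •
      (Iio r).indicator (fun y : ℝ => (y ^ (n - 2))⁻¹ - (r ^ (n - 2))⁻¹) y)
      ((Iio r).indicator fun y => y - (r ^ (n - 2))⁻¹ * y ^ (n - 1)) (Ioi 0) := by
    intro y hy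
    have hy : 0 < y := hy
    by_cases hyr : y < r
    · simp only [indicator, mem_Iio, hyr, if_true, smul_eq_mul]
      have : y ^ (n - 1) = y * y ^ (n - 2) := by rw [← pow_succ']; congr 1; omega
      rw [this]
      field_simp
    · simp [indicator, hyr]
  have hc : Continuous fun y : ℝ => y - (r ^ (n - 2))⁻¹ * y ^ (n - 1) := by fun_prop
  constructor
  · rw [integrable_fun_norm_addHaar, finrank_euclideanSpace_fin]
    refine IntegrableOn.congr_fun ?_ heq.symm measurableSet_Ioi
    rw [IntegrableOn, integrable_indicator_iff measurableSet_Iio, IntegrableOn,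
      Measure.restrict_restrict measurableSet_Iio]
    refine (hc.continuousOn.integrableOn_compact (isCompact_Icc (a := 0) (b := r))).mono_set ?_
    rintro y ⟨h1, h2⟩
    exact ⟨le_of_lt h2, le_of_lt h1⟩
  · rw [integral_fun_norm_addHaar, finrank_euclideanSpace_fin,
      setIntegral_congr_fun measurableSet_Ioi heq, setIntegral_indicator measurableSet_Iio,
      Ioi_inter_Iio, ← integral_Ioc_eq_integral_Ioo, ← intervalIntegral.integral_of_le hr.le,
      intervalIntegral.integral_sub (by apply Continuous.intervalIntegrable; fun_prop)
        (by apply Continuous.intervalIntegrable; fun_prop),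
      intervalIntegral.integral_const_mul, integral_id, integral_pow]
    have e1 : n - 1 + 1 = n := by omega
    have e2 : (((n - 1 : ℕ) : ℝ) + 1) = n := by exact_mod_cast e1
    have e3 : r ^ n = r ^ 2 * r ^ (n - 2) := by rw [← pow_add]; congr 1; omega
    rw [e1, e2, zero_pow (show n ≠ 0 by omega), e3, nsmul_eq_mul, smul_eq_mul]
    field_simp
    ring

/-- The regularised Newtonian kernel is at most the truncated one plus its cut-off level. -/
lemma norm_sq_add_rpow_le_truncated {n : ℕ} (hn : 3 ≤ n) {r ε : ℝ} (hr : 0 < r) {z : Euc n}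
    (hz : z ≠ 0) :
    (‖z‖ ^ 2 + ε ^ 2) ^ ((2 - (n : ℝ)) / 2) ≤
      (Iio r).indicator (fun y : ℝ => (y ^ (n - 2))⁻¹ - (r ^ (n - 2))⁻¹) ‖z‖ +
        (r ^ (n - 2))⁻¹ := by
  have hz0 : 0 < ‖z‖ := norm_pos_iff.2 hz
  have hn' : (3 : ℝ) ≤ n := by exact_mod_cast hn
  have h1 : (‖z‖ ^ 2 + ε ^ 2) ^ ((2 - (n : ℝ)) / 2) ≤ (‖z‖ ^ (n - 2))⁻¹ := by
    have h2 : (‖z‖ ^ 2) ^ ((2 - (n : ℝ)) / 2) = (‖z‖ ^ (n - 2))⁻¹ := by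
      rw [← Real.rpow_natCast ‖z‖ 2, ← Real.rpow_mul hz0.le, ← Real.rpow_natCast ‖z‖ (n - 2),
        ← Real.rpow_neg hz0.le, Nat.cast_sub (by omega)]
      congr 1
      push_cast
      ring
    rw [← h2]
    exact Real.rpow_le_rpow_of_nonpos (by positivity) (by nlinarith [sq_nonneg ε]) (by linarith)
  by_cases hzr : ‖z‖ < r
  · simpa [indicator, hzr] using h1
  · simp only [indicator, mem_Iio, hzr, if_false, zero_add]
    refine h1.trans (inv_anti₀ (by positivity) ?_)
    exact pow_le_pow_left₀ hr.le (not_lt.1 hzr) _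

/-- One-sided form of the potential estimate for Dirichlet eigenfunctions. -/
lemma neg_eigenfunction_le {n : ℕ} (hn : 3 ≤ n) {D : Set (Euc n)} (hDo : IsOpen D)
    (hDb : Bornology.IsBounded D) {lam : ℝ} (hlam : 0 < lam) {u : Euc n → ℝ}
    (hu_cont : ContinuousOn u (closure D)) (hu_smooth : ContDiffOn ℝ 2 u D)
    (hu_bdry : ∀ x ∈ frontier D, u x = 0) (hu_eig : ∀ x ∈ D, -lapl u x = lam * u x)
    {M r : ℝ} (hM : ∀ x ∈ D, |u x| ≤ M) (hr : 0 < r) {x : Euc n} (hx : x ∈ D) :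
    -u x ≤ lam * (M * (r ^ 2 / (2 * n)) + (r ^ (n - 2))⁻¹ *
      (∫ y in D, |u y|) / (n * (n - 2) * (volume : Measure (Euc n)).real (ball 0 1))) := by
  set ω := (volume : Measure (Euc n)).real (ball 0 1) with hω
  have hω0 : 0 < ω := by
    rw [hω, measureReal_def]
    exact ENNReal.toReal_pos (measure_ball_pos _ _ one_pos).ne' measure_ball_lt_top.ne
  have hn0 : 0 < n := by omega
  have hn' : (3 : ℝ) ≤ n := by exact_mod_cast hn
  have : Nonempty (Fin n) := ⟨⟨0, hn0⟩⟩
  have : Nontrivial (Euc n) := inferInstance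
  have hM0 : 0 ≤ M := (abs_nonneg _).trans (hM x hx)
  set V : Euc n → ℝ := D.indicator fun y => |u y| with hVdef
  have hVD : ∀ y ∈ D, V y = |u y| := fun y hy => indicator_of_mem hy _
  have hVc : Continuous V := continuous_indicator (fun y hy => by simp [hu_bdry y hy]) hu_cont.abs
  have hVs : HasCompactSupport V :=
    HasCompactSupport.of_support_subset_isCompact hDb.isCompact_closure
      (support_indicator_subset.trans subset_closure)
  have hVint : Integrable V := hVc.integrable_of_hasCompactSupport hVs
  have hV0 : ∀ y, 0 ≤ V y := fun y => indicator_nonneg (fun _ _ => abs_nonneg _) y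
  have hVM : ∀ y, V y ≤ M := fun y => indicator_apply_le' (hM y) fun _ => hM0
  have hVI : ∫ y, V y = ∫ y in D, |u y| := integral_indicator hDo.measurableSet
  obtain ⟨C, hC⟩ := hDb.closure.exists_norm_le
  have hB : ∀ y ∈ closure D, ‖y‖ ^ 2 ≤ C ^ 2 + 1 := fun y hy => by
    nlinarith [hC y hy, norm_nonneg y]
  refine le_of_forall_pos_le_add fun e he => ?_
  set δ := e / (C ^ 2 + 1) with hδdef
  have hδ : 0 < δ := by positivity
  obtain ⟨ε, hε, hψ⟩ := exists_sub_le_integral_regularised_dirac hn0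
    (hVs.uniformContinuous_of_continuous hVc) hVint hV0 hVM
    (show 0 < n * δ / lam by positivity)
  set p : ℝ := (2 - (n : ℝ)) / 2 with hp
  have hp0 : p ≤ 0 := by rw [hp]; linarith
  set A := lam / (n * (n - 2) * ω) with hA
  have hn2 : (0 : ℝ) < n - 2 := by linarith
  have hA0 : 0 < A := by positivity
  set K : Euc n → ℝ := fun z => (‖z‖ ^ 2 + ε ^ 2) ^ p with hK
  set K₁ : Fin n → Euc n → ℝ := fun i z => 2 * p * z i * (‖z‖ ^ 2 + ε ^ 2) ^ (p - 1) with hK₁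
  set K₂ : Fin n → Euc n → ℝ := fun i z => 2 * p * (‖z‖ ^ 2 + ε ^ 2) ^ (p - 1) +
    4 * p * (p - 1) * z i ^ 2 * (‖z‖ ^ 2 + ε ^ 2) ^ (p - 2) with hK₂
  have hKc : Continuous K := continuous_norm_sq_add_rpow hε p
  have hK₁c : ∀ i, Continuous (K₁ i) := fun i =>
    (by fun_prop : Continuous fun z : Euc n => 2 * p * z i).mul
      (continuous_norm_sq_add_rpow hε _)
  have hK₂c : ∀ i, Continuous (K₂ i) := fun i =>
    (continuous_const.mul (continuous_norm_sq_add_rpow hε _)).add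
      ((by fun_prop : Continuous fun z : Euc n => 4 * p * (p - 1) * z i ^ 2).mul
        (continuous_norm_sq_add_rpow hε _))
  have hKpos : ∀ z, 0 ≤ K z := fun z => by positivity
  have hKb : ∀ z, |K z| ≤ (ε ^ 2) ^ p := fun z => by
    rw [abs_of_nonneg (hKpos z)]
    exact norm_sq_add_rpow_le hε hp0 z
  have hK₂int : ∀ i z, Integrable fun y => K₂ i (z - y) * V y := fun i z =>
    hVint.bdd_mul ((hK₂c i).comp (by fun_prop)).aestronglyMeasurable
      (.of_forall fun y => abs_second_coord_deriv_le hε hp0 i _)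
  have hKint : ∀ z, Integrable fun y => K (z - y) * V y := fun z =>
    hVint.bdd_mul (hKc.comp (by fun_prop)).aestronglyMeasurable (.of_forall fun y => hKb _)
  have hsumK : ∀ z, ∑ i, K₂ i z = -(n * (n - 2)) *
      (ε ^ 2 * (‖z‖ ^ 2 + ε ^ 2) ^ (-((n : ℝ) + 2) / 2)) := by
    intro z
    have hpos : 0 < ‖z‖ ^ 2 + ε ^ 2 := by positivity
    have h1 : ∑ i, z i ^ 2 = ‖z‖ ^ 2 := by
      rw [EuclideanSpace.norm_sq_eq]; simp
    have h2 : (‖z‖ ^ 2 + ε ^ 2) ^ (p - 1) = (‖z‖ ^ 2 + ε ^ 2) * (‖z‖ ^ 2 + ε ^ 2) ^ (p - 2) := by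
      rw [show p - 1 = 1 + (p - 2) by ring, Real.rpow_add hpos, Real.rpow_one]
    simp only [hK₂, Finset.sum_add_distrib, ← Finset.sum_mul, ← Finset.mul_sum, h1, h2,
      Finset.sum_const, Finset.card_univ, Fintype.card_fin, nsmul_eq_mul]
    rw [show -((n : ℝ) + 2) / 2 = p - 2 by rw [hp]; ring, hp]
    ring
  have hwc : Continuous fun z => A * ∫ y, K (z - y) * V y := by
    refine continuous_const.mul (continuous_of_dominated (bound := fun y => (ε ^ 2) ^ p * ‖V y‖)
      (fun z => (hKint z).aestronglyMeasurable) (fun z => .of_forall fun y => ?_)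
      (hVint.norm.const_mul _) (.of_forall fun y => ?_))
    · rw [norm_mul]
      exact mul_le_mul_of_nonneg_right (hKb _) (norm_nonneg _)
    · exact (hKc.comp (by fun_prop)).mul continuous_const
  have hw0 : ∀ z, 0 ≤ A * ∫ y, K (z - y) * V y := fun z =>
    mul_nonneg hA0.le (integral_nonneg fun y => mul_nonneg (hKpos _) (hV0 y))
  have hcomp := neg_le_of_supersolution (w₁ := fun i z => A * ∫ y, K₁ i (z - y) * V y)
    (w₂ := fun i z => A * ∫ y, K₂ i (z - y) * V y) hn0 hDo hDb hlam hu_cont hu_smooth hu_bdry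
    hu_eig hwc hw0
    (fun i z => (hasDerivAt_integral_comp_sub_mul hKc (hK₁c i) hKb
      (abs_coord_mul_rpow_le hε hp0 i) (hasDerivAt_norm_sq_add_rpow hε p i) hVint z).const_mul A)
    (fun i z => (hasDerivAt_integral_comp_sub_mul (hK₁c i) (hK₂c i)
      (abs_coord_mul_rpow_le hε hp0 i) (abs_second_coord_deriv_le hε hp0 i)
      (hasDerivAt_coord_mul_norm_sq_add_rpow hε p i) hVint z).const_mul A)
    hδ hB ?_ hx
  · have hδB : δ * (C ^ 2 + 1) = e := by rw [hδdef]; field_simp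
    rw [hδB] at hcomp
    refine hcomp.trans (add_le_add_left ?_ e)
    obtain ⟨hTint, hTmass⟩ := integral_truncated_newton hn hr
    rw [← hω] at hTmass
    set T : Euc n → ℝ := fun z =>
      (Iio r).indicator (fun y : ℝ => (y ^ (n - 2))⁻¹ - (r ^ (n - 2))⁻¹) ‖z‖ with hT
    have hTsub : Integrable fun y => T (x - y) := hTint.comp_sub_left x
    have hTae : ∀ᵐ y, 0 ≤ T (x - y) ∧ K (x - y) ≤ T (x - y) + (r ^ (n - 2))⁻¹ := by
      filter_upwards [Measure.ae_ne volume x] with y hy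
      have hxy : x - y ≠ 0 := sub_ne_zero.2 hy.symm
      refine ⟨?_, norm_sq_add_rpow_le_truncated hn hr hxy⟩
      refine indicator_apply_nonneg fun h => sub_nonneg.2 ?_
      exact inv_anti₀ (pow_pos (norm_pos_iff.2 hxy) _)
        (pow_le_pow_left₀ (norm_nonneg _) (le_of_lt h) _)
    have hle : ∫ y, K (x - y) * V y ≤ ∫ y, (T (x - y) * M + (r ^ (n - 2))⁻¹ * V y) := by
      refine integral_mono_ae (hKint x) ((hTsub.mul_const M).add (hVint.const_mul _)) ?_
      filter_upwards [hTae] with y hy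
      have h1 := mul_le_mul_of_nonneg_right hy.2 (hV0 y)
      have h2 := mul_le_mul_of_nonneg_left (hVM y) hy.1
      linarith
    rw [integral_add (hTsub.mul_const M) (hVint.const_mul _), integral_mul_const,
      integral_const_mul, integral_sub_left_eq_self, hTmass, hVI] at hle
    refine (mul_le_mul_of_nonneg_left hle hA0.le).trans_eq ?_
    rw [hA]
    field_simp
  · intro z hz
    have h1 := hψ z
    rw [← Finset.mul_sum, ← integral_finsetSum _ fun i _ => hK₂int i z]
    simp_rw [← Finset.sum_mul, hsumK, mul_assoc (-((n : ℝ) * (n - 2)))]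
    rw [integral_const_mul, ← hVD z hz]
    have h2 : A * (n * (n - 2)) = lam / ω := by rw [hA]; field_simp
    have h3 := mul_le_mul_of_nonneg_left h1 (show 0 ≤ lam / ω by positivity)
    have h4 : lam / ω * (ω * (V z - n * δ / lam)) = lam * V z - n * δ := by field_simp
    rw [h4, ← h2] at h3
    linarith

/-- Potential estimate for Dirichlet eigenfunctions. -/
lemma abs_eigenfunction_le {n : ℕ} (hn : 3 ≤ n) {D : Set (Euc n)} (hDo : IsOpen D)
    (hDb : Bornology.IsBounded D) {lam : ℝ} (hlam : 0 < lam) {u : Euc n → ℝ}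
    (hu_cont : ContinuousOn u (closure D)) (hu_smooth : ContDiffOn ℝ 2 u D)
    (hu_bdry : ∀ x ∈ frontier D, u x = 0) (hu_eig : ∀ x ∈ D, -lapl u x = lam * u x)
    {M r : ℝ} (hM : ∀ x ∈ D, |u x| ≤ M) (hr : 0 < r) {x : Euc n} (hx : x ∈ D) :
    |u x| ≤ lam * (M * (r ^ 2 / (2 * n)) + (r ^ (n - 2))⁻¹ *
      (∫ y in D, |u y|) / (n * (n - 2) * (volume : Measure (Euc n)).real (ball 0 1))) := by
  have hneg : ∀ x ∈ D, -lapl (fun y => -u y) x = lam * (-u x) := by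
    intro x hx
    have : lapl (fun y => -u y) x = -lapl u x := by
      simp [lapl, fderiv_fun_neg]
    rw [this, hu_eig x hx]
    ring
  have h1 := neg_eigenfunction_le hn hDo hDb hlam hu_cont.neg hu_smooth.neg
    (fun x hx => by simp [hu_bdry x hx]) hneg (by simpa using hM) hr hx
  have h2 := neg_eigenfunction_le hn hDo hDb hlam hu_cont hu_smooth hu_bdry hu_eig hM hr hx
  simp only [Pi.neg_apply, abs_neg, neg_neg] at h1
  exact abs_le'.2 ⟨h1, h2⟩

/-- Numerical inequality comparing the constant obtained from the potential estimate with the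
stated one. -/
lemma pow_div_four_add_pow_le {n : ℕ} (hn : 3 ≤ n) :
    (n : ℝ) ^ n / 4 + (n : ℝ) ^ (n - 1) ≤
      √(2 * ((n : ℝ) - 2)) ^ (n - 2) * √(((n : ℝ) - 1) ^ 2 + 1) ^ n := by
  set a := √(2 * ((n : ℝ) - 2)) with ha
  set b := √(((n : ℝ) - 1) ^ 2 + 1) with hb
  have hn' : (3 : ℝ) ≤ n := by exact_mod_cast hn
  have ha0 : 0 ≤ a := Real.sqrt_nonneg _
  have hb0 : 0 ≤ b := Real.sqrt_nonneg _
  have ha2 : a ^ 2 = 2 * ((n : ℝ) - 2) := Real.sq_sqrt (by linarith)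
  have hb2 : b ^ 2 = ((n : ℝ) - 1) ^ 2 + 1 := Real.sq_sqrt (by positivity)
  rcases hn.eq_or_lt with h | h
  · have h3 : (n : ℝ) = 3 := by exact_mod_cast h.symm
    rw [h3] at ha2 hb2
    subst h
    refine abs_le_of_sq_le_sq' ?_ (by positivity) |>.2
    have : (a ^ (3 - 2) * b ^ 3) ^ 2 = a ^ 2 * (b ^ 2) ^ 3 := by ring
    rw [this, ha2, hb2]
    norm_num
  · obtain ⟨m, rfl⟩ : ∃ m, n = m + 4 := ⟨n - 4, by omega⟩
    have hN : (4 : ℝ) ≤ ((m + 4 : ℕ) : ℝ) := by exact_mod_cast h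
    set N : ℝ := ((m + 4 : ℕ) : ℝ) with hNdef
    have hbN : N ^ 2 / 2 ≤ b ^ 2 := by rw [hb2]; nlinarith [sq_nonneg (N - 2)]
    have habN : 2 * N ^ 2 ≤ (a * b) ^ 2 := by
      rw [mul_pow, ha2]
      nlinarith [mul_le_mul_of_nonneg_left hbN (show 0 ≤ 2 * (N - 2) by linarith), sq_nonneg N]
    have habN' : N ≤ a * b := by
      refine abs_le_of_sq_le_sq' ?_ (by positivity) |>.2
      nlinarith [sq_nonneg N]
    have h1 : N ^ m ≤ (a * b) ^ m := pow_le_pow_left₀ (by linarith) habN' m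
    have h2 : a ^ (m + 4 - 2) * b ^ (m + 4) = (a * b) ^ m * ((a * b) ^ 2 * b ^ 2) := by
      rw [show m + 4 - 2 = m + 2 by omega]; ring
    have hNm : 0 ≤ N ^ m := by positivity
    have h3 : N ^ m * (2 * N ^ 2 * (N ^ 2 / 2)) ≤ (a * b) ^ m * ((a * b) ^ 2 * b ^ 2) :=
      mul_le_mul h1 (mul_le_mul habN hbN (by positivity) (by positivity)) (by positivity)
        (by positivity)
    rw [h2, show m + 4 - 1 = m + 3 by omega]
    refine le_trans ?_ h3
    have h4 : 0 ≤ N ^ m * N ^ 3 := by positivity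
    have h5 : N ^ (m + 4) = N * (N ^ m * N ^ 3) := by ring
    have h6 : N ^ m * (2 * N ^ 2 * (N ^ 2 / 2)) = N * (N ^ m * N ^ 3) := by ring
    rw [h6, h5, pow_add]
    nlinarith

/-- Passing from the potential estimate at all radii to the stated bound. -/
lemma le_of_potential_estimate {n : ℕ} (hn : 3 ≤ n) {lam ω R M I : ℝ} (hlam : 0 < lam)
    (hω : 0 < ω) (hR : 0 < R) (hM : 0 < M) (hI0 : 0 ≤ I) (hI : I ≤ M * (ω * R ^ n))
    (hK : ∀ r, 0 < r → M ≤ lam * (M * (r ^ 2 / (2 * n)) +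
      (r ^ (n - 2))⁻¹ * I / (n * (n - 2) * ω))) :
    M ≤ 2 / ((n : ℝ) ^ n * ((n : ℝ) - 2) * ω) *
        (lam ^ ((n : ℝ) / 2) * (((n : ℝ) - 1) ^ 2 + 1) ^ ((n : ℝ) / 2)
          - lam * (n : ℝ) ^ (n - 1) / R ^ ((n : ℝ) - 2)) * I := by
  have hn' : (3 : ℝ) ≤ n := by exact_mod_cast hn
  have hn2 : (0 : ℝ) < n - 2 := by linarith
  have hn0 : (0 : ℝ) < n := by linarith
  set a := √(2 * ((n : ℝ) - 2)) with ha
  set l := √lam with hl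
  have ha0 : 0 < a := Real.sqrt_pos.2 (by linarith)
  have hl0 : 0 < l := Real.sqrt_pos.2 hlam
  have ha2 : a ^ 2 = 2 * ((n : ℝ) - 2) := Real.sq_sqrt (by linarith)
  have hl2 : l ^ 2 = lam := Real.sq_sqrt hlam.le
  have hRn : R ^ n = R ^ 2 * R ^ (n - 2) := by rw [← pow_add]; congr 1; omega
  have haR : a / l ≤ R := by
    rw [div_le_iff₀ hl0]
    refine abs_le_of_sq_le_sq' ?_ (by positivity) |>.2
    have h1 : (R ^ (n - 2))⁻¹ * I / (n * (n - 2) * ω) ≤ M * (R ^ 2 / (n * (n - 2))) := by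
      rw [div_le_iff₀ (by positivity), inv_mul_le_iff₀ (by positivity)]
      refine hI.trans_eq ?_
      rw [hRn]
      field_simp
    have h2 : M ≤ lam * (M * (R ^ 2 / (2 * n)) + M * (R ^ 2 / (n * (n - 2)))) :=
      (hK R hR).trans (mul_le_mul_of_nonneg_left (by linarith) hlam.le)
    have h3 : lam * (M * (R ^ 2 / (2 * n)) + M * (R ^ 2 / (n * (n - 2)))) =
        M * (lam * R ^ 2 / (2 * (n - 2))) := by
      field_simp
      ring
    rw [h3] at h2
    have h4 : 1 ≤ lam * R ^ 2 / (2 * ((n : ℝ) - 2)) := by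
      by_contra! h
      nlinarith
    rw [le_div_iff₀ (by linarith)] at h4
    rw [ha2, mul_pow, hl2]
    linarith
  set q := ((a / l) ^ (n - 2))⁻¹ with hq
  have hq0 : 0 < q := by positivity
  have hRq : (R ^ (n - 2))⁻¹ ≤ q :=
    inv_anti₀ (by positivity) (pow_le_pow_left₀ (by positivity) haR _)
  have h1 : M ≤ 1 / (2 * (n - 2) * ω) * (lam * q) * I := by
    have h := hK (a / l) (by positivity)
    rw [div_pow, ha2, hl2] at h
    have e1 : lam * (M * (2 * ((n : ℝ) - 2) / lam / (2 * n)) + q * I / (n * (n - 2) * ω)) =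
        M - M * (2 / n) + lam * q * I / (n * (n - 2) * ω) := by
      field_simp
    rw [e1] at h
    have h2 : M * (2 / n) ≤ lam * q * I / (n * (n - 2) * ω) := by linarith
    have h3 := mul_le_mul_of_nonneg_right h2 (show (0 : ℝ) ≤ n / 2 by positivity)
    calc M = M * (2 / n) * (n / 2) := by field_simp
      _ ≤ _ := h3
      _ = _ := by field_simp
  have e2 : R ^ ((n : ℝ) - 2) = R ^ (n - 2) := by
    rw [← Real.rpow_natCast R (n - 2), Nat.cast_sub (by omega)]
    norm_num
  rw [Real.rpow_div_two_eq_sqrt _ hlam.le, Real.rpow_div_two_eq_sqrt _ (by positivity),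
    Real.rpow_natCast, Real.rpow_natCast, e2]
  refine h1.trans (mul_le_mul_of_nonneg_right ?_ hI0)
  set b := √(((n : ℝ) - 1) ^ 2 + 1) with hb
  have hnum := pow_div_four_add_pow_le hn
  have hlq : l ^ n = lam * q * a ^ (n - 2) := by
    rw [hq, div_pow, ← hl2, show l ^ n = l ^ 2 * l ^ (n - 2) by rw [← pow_add]; congr 1; omega]
    field_simp
  have h5 : (n : ℝ) ^ n / 4 * (lam * q) ≤
      l ^ n * b ^ n - lam * (n : ℝ) ^ (n - 1) / R ^ (n - 2) := by
    have h6 := mul_le_mul_of_nonneg_left hnum (show 0 ≤ lam * q by positivity)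
    have h7 := mul_le_mul_of_nonneg_left hRq (show 0 ≤ lam * (n : ℝ) ^ (n - 1) by positivity)
    rw [div_eq_mul_inv (lam * (n : ℝ) ^ (n - 1)), hlq]
    rw [← ha, ← hb] at h6
    linarith
  calc 1 / (2 * (n - 2) * ω) * (lam * q)
      = 2 / ((n : ℝ) ^ n * ((n : ℝ) - 2) * ω) * ((n : ℝ) ^ n / 4 * (lam * q)) := by
        field_simp
        norm_num
    _ ≤ _ := mul_le_mul_of_nonneg_left h5 (by positivity)

/-- `L^∞`-`L^1` estimate for Dirichlet eigenfunctions of the Laplacian, dimension `n ≥ 3`: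
`‖u‖_∞ ≤ (2/(nⁿ(n-2)ωₙ)) [λ^{n/2}((n-1)²+1)^{n/2} - λ n^{n-1}/R^{n-2}] ‖u‖₁`. -/
theorem eigenfunction_linfty_bound_dim_ge_three
    (n : ℕ) (hn : 3 ≤ n) (D : Set (Euc n)) (hD : D.Nonempty) (hDo : IsOpen D)
    (hDb : Bornology.IsBounded D) (hDc : IsConnected D)
    (lam : ℝ) (hlam : 0 < lam)
    (u : Euc n → ℝ)
    (hu_cont : ContinuousOn u (closure D))
    (hu_smooth : ContDiffOn ℝ 2 u D)
    (hu_bdry : ∀ x ∈ frontier D, u x = 0)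
    (hu_eig : ∀ x ∈ D, -lapl u x = lam * u x)
    (ωn R : ℝ)
    (hωn : ωn = (volume (ball (0 : Euc n) 1)).toReal)
    (hR : R = ((volume D).toReal / ωn) ^ ((1:ℝ)/(n:ℝ))) :
    (⨆ x ∈ D, |u x|) ≤
      2 / ((n:ℝ)^n * ((n:ℝ) - 2) * ωn) *
        (lam ^ ((n:ℝ)/2) * (((n:ℝ) - 1)^2 + 1) ^ ((n:ℝ)/2)
          - lam * (n:ℝ)^(n - 1) / R ^ ((n:ℝ) - 2)) *
        (∫ x in D, |u x|) := by
  have hω0 : 0 < ωn := by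
    rw [hωn]
    exact ENNReal.toReal_pos (measure_ball_pos _ _ one_pos).ne' measure_ball_lt_top.ne
  have hDfin : volume D ≠ ⊤ := hDb.measure_lt_top.ne
  have hD0 : 0 < (volume D).toReal := ENNReal.toReal_pos (hDo.measure_pos _ hD).ne' hDfin
  have hR0 : 0 < R := by rw [hR]; positivity
  have hn0 : n ≠ 0 := by omega
  have hRn : ωn * R ^ n = (volume D).toReal := by
    rw [hR, one_div, Real.rpow_inv_natCast_pow (by positivity) hn0]
    field_simp
  obtain ⟨x₀, hx₀, hmax⟩ :=
    hDb.isCompact_closure.exists_isMaxOn hD.closure hu_cont.abs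
  have hM : ∀ x ∈ D, |u x| ≤ |u x₀| := fun x hx => hmax (subset_closure hx)
  have hI0 : 0 ≤ ∫ x in D, |u x| := integral_nonneg fun _ => abs_nonneg _
  rcases (abs_nonneg (u x₀)).eq_or_lt with h0 | h0
  · have hu0 : ∀ x ∈ D, |u x| = 0 := fun x hx => le_antisymm (h0 ▸ hM x hx) (abs_nonneg _)
    rw [setIntegral_congr_fun hDo.measurableSet hu0]
    simp only [integral_zero, mul_zero]
    exact Real.iSup_le (fun x => Real.iSup_le (fun hx => (hu0 x hx).le) le_rfl) le_rfl
  have hx₀D : x₀ ∈ D := by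
    by_contra hx
    have : x₀ ∈ frontier D := by rw [hDo.frontier_eq]; exact ⟨hx₀, hx⟩
    simp [hu_bdry x₀ this] at h0
  have hI : ∫ x in D, |u x| ≤ |u x₀| * (ωn * R ^ n) := by
    rw [hRn]
    refine (Real.le_norm_self _).trans (norm_setIntegral_le_of_norm_le_const hDb.measure_lt_top ?_)
    simpa using hM
  have key := le_of_potential_estimate hn hlam hω0 hR0 h0 hI0 hI fun r hr => by
    rw [hωn]
    exact abs_eigenfunction_le hn hDo hDb hlam hu_cont hu_smooth hu_bdry hu_eig hM hr hx₀D
  have hrhs := (abs_nonneg (u x₀)).trans key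
  exact Real.iSup_le (fun x => Real.iSup_le (fun hx => (hM x hx).trans key) hrhs) hrhs
end
end
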